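/- For the constant modulus of continuity scenario: for any r = 2, 3, ... and K > 0, sup over f ∈ W^r K of ‖f̃‖_L equals (16K/π) Σ_{i=0}^∞ (−1)^{i(r+1)}/(2i+1)^{r+2}. -/

import Mathlib

open MeasureTheory Real Filter Set

noncomputable section

/-- ω is a concave modulus of continuity. -/
def IsConcaveModulus (ω : ℝ → ℝ) : Prop :=
  Continuous ω ∧ MonotoneOn ω (Ici 0) ∧ ω 0 = 0 ∧
    (∀ s t : ℝ, 0 ≤ s → 0 ≤ t → ω (s + t) ≤ ω s + ω t) ∧
    (∀ t : ℝ, 0 ≤ t → 0 ≤ ω t) ∧ ConcaveOn ℝ (Ici 0) ω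

/-- The Dini condition: ∫₀^ε ω(t)/t dt < ∞ for some ε > 0. -/
def DiniCondition (ω : ℝ → ℝ) : Prop :=
  ∃ ε > 0, IntegrableOn (fun t => ω t / t) (Ioo 0 ε)

/-- f is 2π-periodic with modulus of continuity bounded by ω. -/
def MemH (ω f : ℝ → ℝ) : Prop :=
  Function.Periodic f (2 * π) ∧ ∀ x y : ℝ, |f x - f y| ≤ ω |x - y|

/-- The principal value integral defining the conjugate function converges to L at x. -/
def ConjAt (f : ℝ → ℝ) (x L : ℝ) : Prop :=
  Tendsto (fun δ : ℝ =>
      -(1 / π) * ∫ t in {t : ℝ | δ ≤ |t - x| ∧ |t - x| ≤ π},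
        f t / (2 * Real.tan ((t - x) / 2)))
    (nhdsWithin 0 (Ioi 0)) (nhds L)

/-- g is the trigonometric conjugate of f. -/
def ConjFn (f g : ℝ → ℝ) : Prop := ∀ x : ℝ, ConjAt f x (g x)

/-- f belongs to W^r H_ω. -/
def MemWrH (r : ℕ) (ω f : ℝ → ℝ) : Prop :=
  Function.Periodic f (2 * π) ∧ ContDiff ℝ r f ∧
    ∀ x y : ℝ, |iteratedDeriv r f x - iteratedDeriv r f y| ≤ ω |x - y|

/-- f ∈ W^r K : 2π-periodic, f^(r-1) absolutely continuous with |f^(r)| ≤ K a.e.,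
expressed equivalently as f^(r-1) being K-Lipschitz. -/
def MemWrK (r : ℕ) (K : ℝ) (f : ℝ → ℝ) : Prop :=
  Function.Periodic f (2 * π) ∧ ContDiff ℝ (r - 1) f ∧
    LipschitzWith (Real.toNNReal K) (iteratedDeriv (r - 1) f)

/-- The circle of length `2π`. -/
abbrev Circ : Type := AddCircle (2 * π)

instance fact_two_pi_pos : Fact (0 < 2 * π) := ⟨Real.two_pi_pos⟩

/-- The cosine on the circle. -/
def ccos (x : Circ) : ℝ := Real.Angle.cos x

/-- The sine on the circle. -/
def csin (x : Circ) : ℝ := Real.Angle.sin x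

lemma ccos_coe (t : ℝ) : ccos (t : Circ) = Real.cos t := rfl

lemma csin_coe (t : ℝ) : csin (t : Circ) = Real.sin t := rfl

lemma continuous_ccos : Continuous ccos := Real.Angle.continuous_cos

lemma exists_coe_eq (x : Circ) : ∃ t : ℝ, (t : Circ) = x := QuotientAddGroup.mk_surjective x

lemma ccos_neg (x : Circ) : ccos (-x) = ccos x := Real.Angle.cos_neg x

lemma ccos_sub_comm (x y : Circ) : ccos (x - y) = ccos (y - x) := by
  rw [← ccos_neg, neg_sub]

lemma csin_neg (x : Circ) : csin (-x) = -csin x := Real.Angle.sin_neg x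

lemma ccos_sub_ccos (x y γ : Circ) :
    ccos (x - y) - ccos (x + y - (γ + γ)) = 2 * (csin (x - γ) * csin (y - γ)) := by
  obtain ⟨x, rfl⟩ := exists_coe_eq x
  obtain ⟨y, rfl⟩ := exists_coe_eq y
  obtain ⟨γ, rfl⟩ := exists_coe_eq γ
  simp only [← AddCircle.coe_sub, ← AddCircle.coe_add, ccos_coe, csin_coe]
  have h1 : x - y = (x - γ) - (y - γ) := by ring
  have h2 : x + y - (γ + γ) = (x - γ) + (y - γ) := by ring
  rw [h1, h2, Real.cos_sub, Real.cos_add]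
  ring

lemma exists_add_self (c : Circ) : ∃ γ : Circ, γ + γ = c := by
  obtain ⟨t, rfl⟩ := exists_coe_eq c
  exact ⟨((t / 2 : ℝ) : Circ), by rw [← AddCircle.coe_add, add_halves]⟩

/-- Two-point symmetrization of `Φ` with respect to the reflection `x ↦ γ + γ - x`. -/
def polar (γ : Circ) (Φ : Circ → ℝ) (x : Circ) : ℝ :=
  (Φ x + Φ (γ + γ - x) + Real.sign (csin (x - γ)) * |Φ x - Φ (γ + γ - x)|) / 2

lemma csin_reflect (γ x : Circ) : csin (γ + γ - x - γ) = -csin (x - γ) := by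
  rw [← csin_neg]; congr 1; abel

lemma polar_reflect (γ : Circ) (Φ : Circ → ℝ) (x : Circ) :
    polar γ Φ (γ + γ - x) =
      (Φ x + Φ (γ + γ - x) - Real.sign (csin (x - γ)) * |Φ x - Φ (γ + γ - x)|) / 2 := by
  unfold polar
  rw [csin_reflect, Real.sign_neg, sub_sub_cancel, abs_sub_comm (Φ (γ + γ - x))]
  ring

lemma polar_add_reflect (γ : Circ) (Φ : Circ → ℝ) (x : Circ) :
    polar γ Φ x + polar γ Φ (γ + γ - x) = Φ x + Φ (γ + γ - x) := by
  rw [polar_reflect]; unfold polar; ring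

lemma polar_sub_reflect (γ : Circ) (Φ : Circ → ℝ) (x : Circ) :
    polar γ Φ x - polar γ Φ (γ + γ - x) =
      Real.sign (csin (x - γ)) * |Φ x - Φ (γ + γ - x)| := by
  rw [polar_reflect]; unfold polar; ring

/-- Bounded functions on the circle admitting `ℓ` as a modulus of continuity. -/
def BoundedModulus (M : ℝ) (ℓ : Circ → ℝ) (Φ : Circ → ℝ) : Prop :=
  (∀ x, |Φ x| ≤ M) ∧ ∀ x y, |Φ x - Φ y| ≤ ℓ (x - y)

lemma abs_polarization_le {a a' m s : ℝ} (hs : s = -1 ∨ s = 0 ∨ s = 1) (ha : |a| ≤ m)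
    (ha' : |a'| ≤ m) : |(a + a' + s * |a - a'|) / 2| ≤ m := by
  rw [abs_le] at *
  rcases hs with rfl | rfl | rfl <;> rcases abs_cases (a - a') with h | h <;>
    constructor <;> linarith [h.1, h.2, ha.1, ha.2, ha'.1, ha'.2]

lemma abs_polarization_sub_le {a a' b b' m s t : ℝ} (hs : s = -1 ∨ s = 0 ∨ s = 1)
    (ht : t = -1 ∨ t = 0 ∨ t = 1) (h : |a - b| ≤ m) (h' : |a' - b'| ≤ m)
    (hst : s * t ≤ 0 → |a - b'| ≤ m ∧ |a' - b| ≤ m) :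
    |(a + a' + s * |a - a'|) / 2 - (b + b' + t * |b - b'|) / 2| ≤ m := by
  rw [abs_le] at h h'
  have key : s * t ≤ 0 → (-m ≤ a - b' ∧ a - b' ≤ m) ∧ (-m ≤ a' - b ∧ a' - b ≤ m) := by
    intro h0; simpa only [abs_le] using hst h0
  rw [abs_le]
  obtain ⟨h1, h2⟩ := h
  obtain ⟨h3, h4⟩ := h'
  rcases hs with rfl | rfl | rfl <;> rcases ht with rfl | rfl | rfl <;>
    norm_num at key <;>
    rcases abs_cases (a - a') with ⟨e, e'⟩ | ⟨e, e'⟩ <;>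
    rcases abs_cases (b - b') with ⟨g, g'⟩ | ⟨g, g'⟩ <;> rw [e, g] <;>
    constructor <;> linarith

lemma sign_cases (x : ℝ) : Real.sign x = -1 ∨ Real.sign x = 0 ∨ Real.sign x = 1 := by
  rcases lt_trichotomy x 0 with h | h | h
  · exact Or.inl (Real.sign_of_neg h)
  · exact Or.inr (Or.inl (by rw [h, Real.sign_zero]))
  · exact Or.inr (Or.inr (Real.sign_of_pos h))

lemma mul_nonpos_of_sign_mul_nonpos {x y : ℝ} (h : Real.sign x * Real.sign y ≤ 0) :
    x * y ≤ 0 := by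
  rcases lt_trichotomy x 0 with hx | hx | hx <;> rcases lt_trichotomy y 0 with hy | hy | hy <;>
    first
    | (subst hx; simp)
    | (subst hy; simp)
    | nlinarith
    | (simp only [Real.sign_of_neg, Real.sign_of_pos, hx, hy] at h; norm_num at h)

lemma BoundedModulus.polar {M : ℝ} {ℓ Φ : Circ → ℝ}
    (hℓ : ∀ x y, ccos x ≤ ccos y → ℓ y ≤ ℓ x) (h : BoundedModulus M ℓ Φ) (γ : Circ) :
    BoundedModulus M ℓ (polar γ Φ) := by
  refine ⟨fun x => abs_polarization_le (sign_cases _) (h.1 _) (h.1 _), fun x y => ?_⟩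
  refine abs_polarization_sub_le (sign_cases _) (sign_cases _) (h.2 x y) ?_ fun hs => ?_
  · refine (h.2 _ _).trans (hℓ _ _ (le_of_eq ?_))
    rw [sub_sub_sub_cancel_left, ccos_sub_comm]
  · have h0 := ccos_sub_ccos x y γ
    have h1 := mul_nonpos_of_sign_mul_nonpos hs
    constructor
    · refine (h.2 _ _).trans (hℓ _ _ ?_)
      rw [show x - (γ + γ - y) = x + y - (γ + γ) by abel]
      linarith
    · refine (h.2 _ _).trans (hℓ _ _ ?_)
      rw [show γ + γ - x - y = -(x + y - (γ + γ)) by abel, ccos_neg]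
      linarith

lemma BoundedModulus.continuous {M : ℝ} {ℓ Φ : Circ → ℝ} (hc : Continuous ℓ) (h0 : ℓ 0 = 0)
    (h : BoundedModulus M ℓ Φ) : Continuous Φ := by
  rw [continuous_iff_continuousAt]
  intro x
  have h1 : Tendsto (fun y => ℓ (y - x)) (nhds x) (nhds 0) := by
    have : Continuous fun y => ℓ (y - x) := by fun_prop
    simpa [h0] using this.tendsto x
  rw [ContinuousAt, tendsto_iff_dist_tendsto_zero]
  exact squeeze_zero (fun _ => dist_nonneg) (fun y => by rw [Real.dist_eq]; exact h.2 y x) h1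

lemma Continuous.integrable_circ {f : Circ → ℝ} (hf : Continuous f) : Integrable f :=
  hf.integrable_of_hasCompactSupport (HasCompactSupport.of_compactSpace f)

/-- Convolution on the circle. -/
def conv (E Φ : Circ → ℝ) (x : Circ) : ℝ := ∫ y, E (x - y) * Φ y

/-- The kernel `E`, a strictly increasing function of the cosine. -/
structure CosMono (E : Circ → ℝ) : Prop where
  cont : Continuous E
  lt : ∀ x y, ccos x < ccos y → E x < E y
  eq : ∀ x y, ccos x = ccos y → E x = E y

namespace CosMono

variable {E : Circ → ℝ} (hE : CosMono E) {Φ : Circ → ℝ}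

include hE in
lemma even (x : Circ) : E (-x) = E x := hE.eq _ _ (ccos_neg x)

/-- The antisymmetric part of the kernel under the reflection. -/
def _root_.kerDiff (E : Circ → ℝ) (γ x y : Circ) : ℝ := E (x - y) - E (x + y - (γ + γ))

include hE in
lemma sign_kerDiff (γ x y : Circ) :
    Real.sign (kerDiff E γ x y) = Real.sign (csin (x - γ)) * Real.sign (csin (y - γ)) := by
  have h0 := ccos_sub_ccos x y γ
  unfold kerDiff
  have hm : ∀ a b : ℝ, Real.sign (a * b) = Real.sign a * Real.sign b := by
    intro a b
    rcases lt_trichotomy a 0 with ha | ha | ha <;> rcases lt_trichotomy b 0 with hb | hb | hb <;>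
      first
      | (subst ha; simp)
      | (subst hb; simp)
      | (simp [Real.sign_of_neg, Real.sign_of_pos, ha, hb, mul_pos_of_neg_of_neg,
          mul_neg_of_neg_of_pos, mul_neg_of_pos_of_neg])
  rw [← hm]
  rcases lt_trichotomy (csin (x - γ) * csin (y - γ)) 0 with h | h | h
  · rw [Real.sign_of_neg h, Real.sign_of_neg]
    linarith [hE.lt (x - y) (x + y - (γ + γ)) (by linarith)]
  · rw [h, hE.eq (x - y) (x + y - (γ + γ)) (by rw [h] at h0; linarith), sub_self]
  · rw [Real.sign_of_pos h, Real.sign_of_pos]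
    linarith [hE.lt (x + y - (γ + γ)) (x - y) (by linarith)]

include hE in
lemma continuous_conv (hΦ : Continuous Φ) : Continuous (conv E Φ) := by
  obtain ⟨B, hB⟩ := (isCompact_univ (X := Circ)).exists_bound_of_continuousOn hE.cont.continuousOn
  have hc := hE.cont
  refine continuous_of_dominated (bound := fun y => B * ‖Φ y‖) ?_ ?_ ?_ ?_
  · intro x
    exact (by fun_prop : Continuous fun y => E (x - y) * Φ y).aestronglyMeasurable
  · intro x
    refine Eventually.of_forall fun y => ?_
    rw [norm_mul]
    exact mul_le_mul_of_nonneg_right (hB _ (mem_univ _)) (norm_nonneg _)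
  · exact Continuous.integrable_circ (by fun_prop)
  · exact Eventually.of_forall fun y => by fun_prop

include hE in
lemma conv_reflect (Φ : Circ → ℝ) (γ x : Circ) :
    conv E Φ (γ + γ - x) = ∫ y, E (x + y - (γ + γ)) * Φ y := by
  unfold conv
  congr 1; ext y
  rw [← hE.even]; congr 2; abel

include hE in
lemma conv_add_reflect (hΦ : Continuous Φ) (γ x : Circ) :
    2 * (conv E Φ x + conv E Φ (γ + γ - x)) =
      ∫ y, (E (x - y) + E (x + y - (γ + γ))) * (Φ y + Φ (γ + γ - y)) := by
  have hc := hE.cont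
  have e1 : conv E Φ x + conv E Φ (γ + γ - x) =
      ∫ y, (E (x - y) + E (x + y - (γ + γ))) * Φ y := by
    rw [hE.conv_reflect, conv, ← integral_add (Continuous.integrable_circ (by fun_prop))
      (Continuous.integrable_circ (by fun_prop))]
    congr 1; ext y; ring
  have e2 : ∫ y, (E (x - y) + E (x + y - (γ + γ))) * Φ y =
      ∫ y, (E (x - y) + E (x + y - (γ + γ))) * Φ (γ + γ - y) := by
    rw [← integral_sub_left_eq_self _ _ (γ + γ)]
    congr 1; ext y
    rw [show x - (γ + γ - y) = x + y - (γ + γ) by abel,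
      show x + (γ + γ - y) - (γ + γ) = x - y by abel]
    ring
  rw [two_mul, e1]
  nth_rewrite 2 [e2]
  rw [← integral_add (Continuous.integrable_circ (by fun_prop))
      (Continuous.integrable_circ (by fun_prop))]
  congr 1; ext y; ring

include hE in
lemma conv_sub_reflect (hΦ : Continuous Φ) (γ x : Circ) :
    2 * (conv E Φ x - conv E Φ (γ + γ - x)) =
      ∫ y, kerDiff E γ x y * (Φ y - Φ (γ + γ - y)) := by
  have hc := hE.cont
  unfold kerDiff
  have e1 : conv E Φ x - conv E Φ (γ + γ - x) =
      ∫ y, (E (x - y) - E (x + y - (γ + γ))) * Φ y := by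
    rw [hE.conv_reflect, conv, ← integral_sub (Continuous.integrable_circ (by fun_prop))
      (Continuous.integrable_circ (by fun_prop))]
    congr 1; ext y; ring
  have e2 : ∫ y, (E (x - y) - E (x + y - (γ + γ))) * Φ y =
      ∫ y, -((E (x - y) - E (x + y - (γ + γ))) * Φ (γ + γ - y)) := by
    rw [← integral_sub_left_eq_self _ _ (γ + γ)]
    congr 1; ext y
    rw [show x - (γ + γ - y) = x + y - (γ + γ) by abel,
      show x + (γ + γ - y) - (γ + γ) = x - y by abel]
    ring
  rw [two_mul, e1]
  nth_rewrite 2 [e2]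
  rw [← integral_add (Continuous.integrable_circ (by fun_prop))
      (Continuous.integrable_circ (by fun_prop))]
  congr 1; ext y; ring

include hE in
lemma conv_polar_sub_reflect (γ x : Circ)
    (hp : Continuous (polar γ Φ)) :
    2 * (conv E (polar γ Φ) x - conv E (polar γ Φ) (γ + γ - x)) =
      Real.sign (csin (x - γ)) * ∫ y, |kerDiff E γ x y * (Φ y - Φ (γ + γ - y))| := by
  rw [hE.conv_sub_reflect hp, ← integral_const_mul]
  congr 1; ext y
  rw [polar_sub_reflect, abs_mul]
  have h := hE.sign_kerDiff γ x y
  have h2 : kerDiff E γ x y = Real.sign (kerDiff E γ x y) * |kerDiff E γ x y| := by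
    rcases lt_trichotomy (kerDiff E γ x y) 0 with h | h | h
    · rw [Real.sign_of_neg h, abs_of_neg h]; ring
    · rw [h]; simp
    · rw [Real.sign_of_pos h, abs_of_pos h]; ring
  by_cases hy : csin (y - γ) = 0
  · have : kerDiff E γ x y = 0 := by rw [h2, h, hy]; simp
    simp [this]
  · have hs : Real.sign (csin (y - γ)) * Real.sign (csin (y - γ)) = 1 := by
      rcases lt_or_gt_of_ne hy with h | h
      · rw [Real.sign_of_neg h]; norm_num
      · rw [Real.sign_of_pos h]; norm_num
    nth_rewrite 1 [h2]
    rw [h]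
    linear_combination (Real.sign (csin (x - γ)) * |kerDiff E γ x y| * |Φ y - Φ (γ + γ - y)|) * hs

include hE in
lemma conv_polar_add_reflect (hΦ : Continuous Φ) (γ x : Circ)
    (hp : Continuous (polar γ Φ)) :
    conv E (polar γ Φ) x + conv E (polar γ Φ) (γ + γ - x) =
      conv E Φ x + conv E Φ (γ + γ - x) := by
  have h1 := hE.conv_add_reflect hp γ x
  simp_rw [polar_add_reflect] at h1
  rw [← hE.conv_add_reflect hΦ] at h1
  linarith

include hE in
lemma abs_conv_sub_le (hΦ : Continuous Φ) (γ x : Circ) (hp : Continuous (polar γ Φ)) :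
    |conv E Φ x - conv E Φ (γ + γ - x)| ≤
      |conv E (polar γ Φ) x - conv E (polar γ Φ) (γ + γ - x)| := by
  have h1 := hE.conv_sub_reflect hΦ γ x
  have h2 := hE.conv_polar_sub_reflect γ x hp
  have h4 : |∫ y, kerDiff E γ x y * (Φ y - Φ (γ + γ - y))| ≤
    ∫ y, |kerDiff E γ x y * (Φ y - Φ (γ + γ - y))| := abs_integral_le_integral_abs
  by_cases hx : csin (x - γ) = 0
  · have h3 : ∀ y, kerDiff E γ x y = 0 := by
      intro y
      have := hE.sign_kerDiff γ x y
      rw [hx, Real.sign_zero, zero_mul] at this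
      exact Real.sign_eq_zero_iff.1 this
    simp only [h3, zero_mul, integral_zero] at h1
    have : conv E Φ x - conv E Φ (γ + γ - x) = 0 := by linarith
    rw [this, abs_zero]; positivity
  · have hs : |Real.sign (csin (x - γ))| = 1 := by
      rcases lt_or_gt_of_ne hx with h | h
      · rw [Real.sign_of_neg h]; norm_num
      · rw [Real.sign_of_pos h]; norm_num
    have h5 := congrArg abs h1
    have h6 := congrArg abs h2
    rw [abs_mul, abs_two] at h5 h6
    rw [abs_mul, hs, one_mul, abs_of_nonneg (integral_nonneg fun _ => abs_nonneg _)] at h6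
    linarith

end CosMono

lemma integral_add_reflect {F : Circ → ℝ} (hF : Continuous F) (c : Circ) :
    ∫ x, (F x + F (c - x)) = 2 * ∫ x, F x := by
  rw [integral_add hF.integrable_circ (Continuous.integrable_circ (by fun_prop)),
    integral_sub_left_eq_self F volume c]
  ring

lemma eq_zero_of_integral_nonpos {F : Circ → ℝ} (hF : Continuous F) (h0 : ∀ x, 0 ≤ F x)
    (h : ∫ x, F x ≤ 0) (x : Circ) : F x = 0 := by
  by_contra hx
  exact absurd (hF.integral_pos_of_hasCompactSupport_nonneg_nonzero (μ := volume)
    (HasCompactSupport.of_compactSpace F) h0 hx) (not_lt.2 h)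

lemma abs_add_abs_le_of_sub_le {p q p' q' : ℝ} (h : p' + q' = p + q)
    (h' : |p - q| ≤ |p' - q'|) : |p| + |q| ≤ |p'| + |q'| := by
  rcases abs_cases (p - q) with h1 | h1 <;> rcases abs_cases (p' - q') with h2 | h2 <;>
  rcases abs_cases p with h3 | h3 <;> rcases abs_cases q with h4 | h4 <;>
  rcases abs_cases p' with h5 | h5 <;> rcases abs_cases q' with h6 | h6 <;> linarith

namespace CosMono

variable {E : Circ → ℝ} (hE : CosMono E) {Φ : Circ → ℝ}

include hE in
lemma integral_abs_conv_le_polar (hΦ : Continuous Φ) (γ : Circ)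
    (hp : Continuous (polar γ Φ)) :
    ∫ x, |conv E Φ x| ≤ ∫ x, |conv E (polar γ Φ) x| := by
  have c1 := hE.continuous_conv hΦ
  have c2 := hE.continuous_conv hp
  have h1 := integral_add_reflect c1.abs (γ + γ)
  have h2 := integral_add_reflect c2.abs (γ + γ)
  have h3 : ∫ x, (|conv E Φ x| + |conv E Φ (γ + γ - x)|) ≤
      ∫ x, (|conv E (polar γ Φ) x| + |conv E (polar γ Φ) (γ + γ - x)|) := by
    refine integral_mono (Continuous.integrable_circ (by fun_prop))
      (Continuous.integrable_circ (by fun_prop)) fun x => ?_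
    exact abs_add_abs_le_of_sub_le (hE.conv_polar_add_reflect hΦ γ x hp)
      (hE.abs_conv_sub_le hΦ γ x hp)
  linarith

include hE in
lemma sq_gap_nonneg (hΦ : Continuous Φ) (γ : Circ) (hp : Continuous (polar γ Φ)) (x : Circ) :
    (conv E Φ x - conv E Φ (γ + γ - x)) ^ 2 ≤
      (conv E (polar γ Φ) x - conv E (polar γ Φ) (γ + γ - x)) ^ 2 :=
  sq_le_sq.2 (hE.abs_conv_sub_le hΦ γ x hp)

include hE in
lemma integral_sq_gap (hΦ : Continuous Φ) (γ : Circ) (hp : Continuous (polar γ Φ)) :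
    ∫ x, ((conv E (polar γ Φ) x - conv E (polar γ Φ) (γ + γ - x)) ^ 2 -
      (conv E Φ x - conv E Φ (γ + γ - x)) ^ 2) =
      4 * (∫ x, conv E (polar γ Φ) x ^ 2) - 4 * ∫ x, conv E Φ x ^ 2 := by
  have c1 := hE.continuous_conv hΦ
  have c2 := hE.continuous_conv hp
  have h1 := integral_add_reflect (F := fun x => conv E Φ x ^ 2) (c1.pow 2) (γ + γ)
  have h2 := integral_add_reflect (F := fun x => conv E (polar γ Φ) x ^ 2) (c2.pow 2) (γ + γ)
  have h3 : ∫ x, ((conv E (polar γ Φ) x - conv E (polar γ Φ) (γ + γ - x)) ^ 2 -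
      (conv E Φ x - conv E Φ (γ + γ - x)) ^ 2) =
      ∫ x, (2 * (conv E (polar γ Φ) x ^ 2 + conv E (polar γ Φ) (γ + γ - x) ^ 2) -
        2 * (conv E Φ x ^ 2 + conv E Φ (γ + γ - x) ^ 2)) := by
    congr 1; ext x
    have h := hE.conv_polar_add_reflect hΦ γ x hp
    linear_combination -(conv E (polar γ Φ) x + conv E (polar γ Φ) (γ + γ - x) +
      conv E Φ x + conv E Φ (γ + γ - x)) * h
  rw [h3, integral_sub (Continuous.integrable_circ (by fun_prop))
    (Continuous.integrable_circ (by fun_prop)), integral_const_mul, integral_const_mul, h1, h2]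
  ring

include hE in
include hE in
/-- If no two-point symmetrization increases the energy, then the convolution is symmetric
decreasing about one of its maximum points. -/
lemma exists_symmetric_decreasing (hΦ : Continuous Φ)
    (hp : ∀ γ, Continuous (polar γ Φ))
    (hmax : ∀ γ, ∫ x, conv E (polar γ Φ) x ^ 2 ≤ ∫ x, conv E Φ x ^ 2) :
    ∃ p, ∀ x y, ccos (y - p) < ccos (x - p) → conv E Φ y ≤ conv E Φ x := by
  have cv := hE.continuous_conv hΦ
  have cE := hE.cont
  obtain ⟨p, -, hpmax⟩ := (isCompact_univ (X := Circ)).exists_isMaxOn univ_nonempty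
    cv.continuousOn
  refine ⟨p, fun x y hxy => ?_⟩
  obtain ⟨γ, hγ⟩ := exists_add_self (x + y)
  have cpol := hE.continuous_conv (hp γ)
  have hσ : γ + γ - x = y := by rw [hγ]; abel
  have hw := ccos_sub_ccos x p γ
  rw [show x + p - (γ + γ) = -(y - p) by rw [hγ]; abel, ccos_neg] at hw
  have hw0 : 0 < csin (x - γ) * csin (p - γ) := by linarith
  have hsign : Real.sign (csin (x - γ)) = Real.sign (csin (p - γ)) := by
    rcases pos_and_pos_or_neg_and_neg_of_mul_pos hw0 with ⟨h, h'⟩ | ⟨h, h'⟩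
    · rw [Real.sign_of_pos h, Real.sign_of_pos h']
    · rw [Real.sign_of_neg h, Real.sign_of_neg h']
  have hsp : |Real.sign (csin (p - γ))| = 1 := by
    rcases pos_and_pos_or_neg_and_neg_of_mul_pos hw0 with ⟨h, h'⟩ | ⟨h, h'⟩
    · rw [Real.sign_of_pos h']; norm_num
    · rw [Real.sign_of_neg h']; norm_num
  have hgap := eq_zero_of_integral_nonpos (F := fun x =>
      (conv E (polar γ Φ) x - conv E (polar γ Φ) (γ + γ - x)) ^ 2 -
      (conv E Φ x - conv E Φ (γ + γ - x)) ^ 2) (by fun_prop)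
      (fun x => sub_nonneg.2 (hE.sq_gap_nonneg hΦ γ (hp γ) x))
      (by rw [hE.integral_sq_gap hΦ γ (hp γ)]; linarith [hmax γ]) p
  have habs : |conv E (polar γ Φ) p - conv E (polar γ Φ) (γ + γ - p)| =
      |conv E Φ p - conv E Φ (γ + γ - p)| := (sq_eq_sq_iff_abs_eq_abs _ _).1 (sub_eq_zero.1 hgap)
  have h1 := hE.conv_sub_reflect hΦ γ p
  have h2 := congrArg abs (hE.conv_polar_sub_reflect γ p (hp γ))
  have hpp : conv E Φ (γ + γ - p) ≤ conv E Φ p := hpmax (mem_univ _)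
  rw [abs_mul, abs_mul, hsp, one_mul, habs, abs_two, abs_of_nonneg (sub_nonneg.2 hpp), h1,
    abs_of_nonneg (integral_nonneg fun _ => abs_nonneg _)] at h2
  have cker : ∀ z, Continuous fun y => kerDiff E γ z y * (Φ y - Φ (γ + γ - y)) := by
    intro z; unfold kerDiff; fun_prop
  have hpt := eq_zero_of_integral_nonpos (F := fun y =>
      |kerDiff E γ p y * (Φ y - Φ (γ + γ - y))| - kerDiff E γ p y * (Φ y - Φ (γ + γ - y)))
      ((cker p).abs.sub (cker p)) (fun y => sub_nonneg.2 (le_abs_self _))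
      (by rw [integral_sub (cker p).abs.integrable_circ (cker p).integrable_circ]; linarith)
  have hpos : ∀ y, 0 ≤ kerDiff E γ x y * (Φ y - Φ (γ + γ - y)) := by
    intro y
    have h3 : 0 ≤ kerDiff E γ p y * (Φ y - Φ (γ + γ - y)) := by
      have := hpt y
      have := abs_nonneg (kerDiff E γ p y * (Φ y - Φ (γ + γ - y)))
      linarith
    have h4 : Real.sign (kerDiff E γ x y) = Real.sign (kerDiff E γ p y) := by
      rw [hE.sign_kerDiff, hE.sign_kerDiff, hsign]
    rcases lt_trichotomy (kerDiff E γ x y) 0 with h | h | h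
    · have h5 : kerDiff E γ p y < 0 := by
        by_contra hcon
        rw [Real.sign_of_neg h] at h4
        rcases (not_lt.1 hcon).eq_or_lt with h6 | h6
        · rw [← h6, Real.sign_zero] at h4; norm_num at h4
        · rw [Real.sign_of_pos h6] at h4; norm_num at h4
      exact mul_nonneg_of_nonpos_of_nonpos h.le (nonpos_of_mul_nonneg_right h3 h5)
    · rw [h, zero_mul]
    · have h5 : 0 < kerDiff E γ p y := by
        by_contra hcon
        rw [Real.sign_of_pos h] at h4
        rcases (not_lt.1 hcon).eq_or_lt with h6 | h6
        · rw [h6, Real.sign_zero] at h4; norm_num at h4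
        · rw [Real.sign_of_neg h6] at h4; norm_num at h4
      exact mul_nonneg h.le (nonneg_of_mul_nonneg_right h3 h5)
  have h7 := hE.conv_sub_reflect hΦ γ x
  rw [hσ] at h7
  have h8 : 0 ≤ ∫ y, kerDiff E γ x y * (Φ y - Φ (γ + γ - y)) := integral_nonneg hpos
  linarith

open BoundedContinuousFunction in
include hE in
lemma continuousOn_integral_conv {M : ℝ} {θ : ℝ → ℝ} (hθ : Continuous θ) :
    ContinuousOn (fun Φ : Circ →ᵇ ℝ => ∫ x, θ (conv E Φ x)) {Φ | ∀ x, |Φ x| ≤ M} := by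
  have cE := hE.cont
  obtain ⟨B, hB⟩ := (isCompact_univ (X := Circ)).exists_bound_of_continuousOn cE.continuousOn
  have hc : ∀ x, ContinuousOn (fun Φ : Circ →ᵇ ℝ => conv E Φ x) {Φ | ∀ x, |Φ x| ≤ M} := by
    intro x
    refine continuousOn_of_dominated (bound := fun _ => B * M) ?_ ?_ (integrable_const _) ?_
    · intro Φ _
      exact (by fun_prop : Continuous fun y => E (x - y) * Φ y).aestronglyMeasurable
    · intro Φ hΦ
      refine Eventually.of_forall fun y => ?_
      rw [norm_mul]
      exact mul_le_mul (hB _ (mem_univ _)) (hΦ y) (norm_nonneg _)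
        ((norm_nonneg _).trans (hB 0 (mem_univ _)))
    · refine Eventually.of_forall fun y => Continuous.continuousOn ?_
      exact continuous_const.mul (continuous_eval_const (F := Circ →ᵇ ℝ) y)
  have hb : ∀ Φ : Circ →ᵇ ℝ, (∀ x, |Φ x| ≤ M) → ∀ x,
      conv E Φ x ∈ Metric.closedBall (0 : ℝ) (B * M * (volume : Measure Circ).real univ) := by
    intro Φ hΦ x
    rw [mem_closedBall_zero_iff]
    refine norm_integral_le_of_norm_le_const (Eventually.of_forall fun y => ?_)
    rw [norm_mul]
    exact mul_le_mul (hB _ (mem_univ _)) (hΦ y) (norm_nonneg _)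
        ((norm_nonneg _).trans (hB 0 (mem_univ _)))
  obtain ⟨C, hC⟩ := (isCompact_closedBall (0 : ℝ)
    (B * M * (volume : Measure Circ).real univ)).exists_bound_of_continuousOn hθ.continuousOn
  refine continuousOn_of_dominated (bound := fun _ => C) ?_ ?_ (integrable_const _) ?_
  · intro Φ _
    exact (hθ.comp (hE.continuous_conv Φ.continuous)).aestronglyMeasurable
  · intro Φ hΦ
    exact Eventually.of_forall fun x => hC _ (hb Φ hΦ x)
  · exact Eventually.of_forall fun x => hθ.comp_continuousOn (hc x)

open BoundedContinuousFunction in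
lemma isCompact_boundedModulus {M : ℝ} {ℓ : Circ → ℝ} (hc : Continuous ℓ) (h0 : ℓ 0 = 0) :
    IsCompact {Φ : Circ →ᵇ ℝ | BoundedModulus M ℓ Φ} := by
  refine arzela_ascoli₂ (Icc (-M) M) isCompact_Icc _ ?_ ?_ ?_
  · have e (x : Circ) : Continuous fun Φ : Circ →ᵇ ℝ => Φ x := continuous_eval_const x
    simp only [BoundedModulus, ofPred_and, ofPred_forall]
    refine IsClosed.inter (isClosed_iInter fun x => isClosed_le (e x).abs continuous_const)
      (isClosed_iInter fun x => isClosed_iInter fun y =>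
        isClosed_le ((e x).sub (e y)).abs continuous_const)
  · intro Φ x hΦ
    exact abs_le.1 (hΦ.1 x)
  · intro x
    have h1 : Tendsto (fun y => ℓ (x - y)) (nhds x) (nhds 0) := by
      have : Continuous fun y => ℓ (x - y) := by fun_prop
      simpa [h0] using this.tendsto x
    rw [Metric.equicontinuousAt_iff_right]
    intro ε hε
    filter_upwards [h1.eventually (gt_mem_nhds hε)] with y hy Φ
    rw [Real.dist_eq]
    exact (Φ.2.2 x y).trans_lt hy

open BoundedContinuousFunction in
include hE in
/-- Among functions with a prescribed bound and modulus of continuity, the `L¹` norm of the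
convolution is maximized by one whose convolution is symmetric decreasing. -/
theorem exists_maximizer {M : ℝ} {ℓ : Circ → ℝ} (hc : Continuous ℓ) (h0 : ℓ 0 = 0)
    (hℓ : ∀ x y, ccos x ≤ ccos y → ℓ y ≤ ℓ x) (hΦ : BoundedModulus M ℓ Φ) :
    ∃ Ψ, BoundedModulus M ℓ Ψ ∧ ∫ x, |conv E Φ x| ≤ ∫ x, |conv E Ψ x| ∧
      ∃ p, ∀ x y, ccos (y - p) < ccos (x - p) → conv E Ψ y ≤ conv E Ψ x := by
  set S : Set (Circ →ᵇ ℝ) := {Φ | BoundedModulus M ℓ Φ} with hS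
  have hcomp : IsCompact S := isCompact_boundedModulus hc h0
  have hsub : S ⊆ {Φ : Circ →ᵇ ℝ | ∀ x, |Φ x| ≤ M} := fun Φ h => h.1
  let lift (Φ : Circ → ℝ) (h : BoundedModulus M ℓ Φ) : Circ →ᵇ ℝ :=
    mkOfCompact ⟨Φ, h.continuous hc h0⟩
  have hJ : ContinuousOn (fun Φ : Circ →ᵇ ℝ => ∫ x, |conv E Φ x|) S :=
    (hE.continuousOn_integral_conv continuous_abs).mono hsub
  have hJ2 : ContinuousOn (fun Φ : Circ →ᵇ ℝ => ∫ x, conv E Φ x ^ 2) S :=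
    (hE.continuousOn_integral_conv (continuous_pow 2)).mono hsub
  obtain ⟨Ψ₀, hΨ₀, hmax₀⟩ := hcomp.exists_isMaxOn ⟨lift Φ hΦ, hΦ⟩ hJ
  have hcl : IsCompact (S ∩ (fun Φ : Circ →ᵇ ℝ => ∫ x, |conv E Φ x|) ⁻¹'
      Ici (∫ x, |conv E Ψ₀ x|)) :=
    hcomp.of_isClosed_subset (hJ.preimage_isClosed_of_isClosed hcomp.isClosed isClosed_Ici)
      inter_subset_left
  obtain ⟨Ψ, hΨ, hmax⟩ := hcl.exists_isMaxOn ⟨Ψ₀, hΨ₀, mem_preimage.2 self_mem_Ici⟩ (hJ2.mono inter_subset_left)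
  refine ⟨Ψ, hΨ.1, (hmax₀ (a := lift Φ hΦ) hΦ).trans hΨ.2, ?_⟩
  have hpol : ∀ γ, BoundedModulus M ℓ (polar γ Ψ) := fun γ => hΨ.1.polar hℓ γ
  refine hE.exists_symmetric_decreasing Ψ.continuous (fun γ => (hpol γ).continuous hc h0) fun γ => ?_
  refine hmax (a := lift _ (hpol γ)) ⟨hpol γ, mem_preimage.2 (mem_Ici.2 (le_trans (mem_Ici.1 (mem_preimage.1 hΨ.2)) ?_))⟩
  exact hE.integral_abs_conv_le_polar Ψ.continuous γ ((hpol γ).continuous hc h0)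

end CosMono

lemma arccos_cos_le_abs (u : ℝ) : Real.arccos (Real.cos u) ≤ |u| := by
  rcases le_total |u| π with h | h
  · rw [← Real.cos_abs, Real.arccos_cos (abs_nonneg u) h]
  · exact (Real.arccos_le_pi _).trans h

lemma abs_sub_le_mul_arccos {Φ : ℝ → ℝ} {L : ℝ} (hper : Function.Periodic Φ (2 * π))
    (hLip : ∀ s t, |Φ s - Φ t| ≤ L * |s - t|) (s t : ℝ) :
    |Φ s - Φ t| ≤ L * Real.arccos (Real.cos (s - t)) := by
  obtain ⟨n, hn, -⟩ := existsUnique_sub_zsmul_mem_Ioc Real.two_pi_pos (s - t) (-π)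
  simp only [zsmul_eq_mul, mem_Ioc] at hn
  have h := hLip (s - n * (2 * π)) t
  have habs : |s - n * (2 * π) - t| ≤ π := by
    rw [abs_le]; constructor <;> linarith [hn.1, hn.2]
  rw [hper.sub_int_mul_eq n] at h
  rwa [← Real.arccos_cos (abs_nonneg (s - n * (2 * π) - t)) habs, Real.cos_abs,
    show s - n * (2 * π) - t = s - t - n * (2 * π) by ring, Real.cos_sub_int_mul_two_pi] at h

lemma integral_circ_eq (f : Circ → ℝ) (a : ℝ) :
    ∫ x, f x = ∫ t in a..a + 2 * π, f (t : Circ) :=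
  (AddCircle.intervalIntegral_preimage (2 * π) a f).symm

lemma integral_circ_eq_symm (f : Circ → ℝ) :
    ∫ x, f x = ∫ t in -π..π, f (t : Circ) := by
  rw [integral_circ_eq f (-π), show -π + 2 * π = π by ring]

/-- The `L¹` norm of a convolution with a kernel decreasing away from the origin is at most that
of a symmetric decreasing convolution. -/
lemma exists_symmetric_maximizer {E Φ : ℝ → ℝ} {M L : ℝ} (hL : 0 ≤ L) (hE : Continuous E)
    (hlt : ∀ s t, Real.cos s < Real.cos t → E s < E t)
    (heq : ∀ s t, Real.cos s = Real.cos t → E s = E t)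
    (hper : Function.Periodic Φ (2 * π)) (hM : ∀ t, |Φ t| ≤ M)
    (hLip : ∀ s t, |Φ s - Φ t| ≤ L * |s - t|) :
    ∃ Ψ : ℝ → ℝ, Function.Periodic Ψ (2 * π) ∧ (∀ t, |Ψ t| ≤ M) ∧
      (∀ s t, |Ψ s - Ψ t| ≤ L * |s - t|) ∧
      (∫ x in (0)..(2 * π), |∫ t in -π..π, Φ (x + t) * E t|) ≤
        (∫ x in -π..π, |∫ y in -π..π, E (x - y) * Ψ y|) ∧
      ∀ s t, |s| ≤ π → |t| ≤ π → |s| < |t| →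
        (∫ y in -π..π, E (t - y) * Ψ y) ≤ ∫ y in -π..π, E (s - y) * Ψ y := by
  have hEper : Function.Periodic E (2 * π) := fun t => heq _ _ (Real.cos_periodic t)
  set EC : Circ → ℝ := hEper.lift with hEC
  set ΦC : Circ → ℝ := hper.lift with hΦC
  have eEC : ∀ t : ℝ, EC (t : Circ) = E t := fun t => hEper.lift_coe t
  have eΦC : ∀ t : ℝ, ΦC (t : Circ) = Φ t := fun t => hper.lift_coe t
  have hmono : CosMono EC := by
    refine ⟨?_, fun x y => ?_, fun x y => ?_⟩
    · exact continuous_coinduced_dom.2 hE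
    · obtain ⟨s, rfl⟩ := exists_coe_eq x
      obtain ⟨t, rfl⟩ := exists_coe_eq y
      simpa [eEC, ccos_coe] using hlt s t
    · obtain ⟨s, rfl⟩ := exists_coe_eq x
      obtain ⟨t, rfl⟩ := exists_coe_eq y
      simpa [eEC, ccos_coe] using heq s t
  set ℓ : Circ → ℝ := fun x => L * Real.arccos (ccos x) with hℓ
  have hℓc : Continuous ℓ := continuous_const.mul (Real.continuous_arccos.comp continuous_ccos)
  have hℓ0 : ℓ 0 = 0 := by
    have : ccos 0 = 1 := by simpa using ccos_coe 0
    simp [hℓ, this]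
  have hℓm : ∀ x y, ccos x ≤ ccos y → ℓ y ≤ ℓ x := fun x y h =>
    mul_le_mul_of_nonneg_left (Real.antitone_arccos h) hL
  have hΦmod : BoundedModulus M ℓ ΦC := by
    refine ⟨fun x => ?_, fun x y => ?_⟩
    · obtain ⟨s, rfl⟩ := exists_coe_eq x
      simpa [eΦC] using hM s
    · obtain ⟨s, rfl⟩ := exists_coe_eq x
      obtain ⟨t, rfl⟩ := exists_coe_eq y
      simp only [eΦC, hℓ, ← AddCircle.coe_sub, ccos_coe]
      exact abs_sub_le_mul_arccos hper hLip s t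
  obtain ⟨Ψ, hΨ, hle, p, hp⟩ := hmono.exists_maximizer hℓc hℓ0 hℓm hΦmod
  obtain ⟨q, rfl⟩ := exists_coe_eq p
  have hconv : ∀ t : ℝ, conv EC Ψ ((q + t : ℝ) : Circ) =
      ∫ y in -π..π, E (t - y) * Ψ ((q + y : ℝ) : Circ) := by
    intro t
    rw [conv, ← integral_add_left_eq_self _ (q : Circ), integral_circ_eq_symm]
    refine intervalIntegral.integral_congr fun y _ => ?_
    simp only [← eEC, AddCircle.coe_add, AddCircle.coe_sub, add_sub_add_left_eq_sub]
  refine ⟨fun t => Ψ ((q + t : ℝ) : Circ), fun t => ?_, fun t => hΨ.1 _, fun s t => ?_, ?_, ?_⟩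
  · simp only [← add_assoc]
    congr 1
    exact AddCircle.coe_add_period (2 * π) (q + t)
  · refine (hΨ.2 _ _).trans ?_
    simp only [hℓ, ← AddCircle.coe_sub, ccos_coe, add_sub_add_left_eq_sub]
    exact mul_le_mul_of_nonneg_left (arccos_cos_le_abs _) hL
  · have h1 : (∫ x in (0)..(2 * π), |∫ t in -π..π, Φ (x + t) * E t|) = ∫ x, |conv EC ΦC x| := by
      rw [integral_circ_eq _ 0, zero_add]
      refine intervalIntegral.integral_congr fun x _ => congrArg abs ?_
      rw [conv, ← integral_add_left_eq_self _ (x : Circ), integral_circ_eq_symm]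
      refine intervalIntegral.integral_congr fun t _ => ?_
      simp only [← eEC, ← eΦC, AddCircle.coe_add, sub_add_cancel_left]
      rw [hmono.even, mul_comm]
    have h2 : (∫ x in -π..π, |∫ y in -π..π, E (x - y) * Ψ ((q + y : ℝ) : Circ)|) =
        ∫ x, |conv EC Ψ x| := by
      rw [← integral_add_left_eq_self _ (q : Circ), integral_circ_eq_symm]
      refine intervalIntegral.integral_congr fun x _ => ?_
      rw [← hconv, AddCircle.coe_add]
    rw [h1, h2]
    exact hle
  · intro s t hs ht hst
    rw [← hconv, ← hconv]
    refine hp _ _ ?_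
    simp only [← AddCircle.coe_sub, ccos_coe, add_sub_cancel_left]
    rw [← Real.cos_abs t, ← Real.cos_abs s]
    exact Real.strictAntiOn_cos ⟨abs_nonneg s, hs⟩ ⟨abs_nonneg t, ht⟩ hst

lemma exists_sign_threshold {g : ℝ → ℝ}
    (h : ∀ s t, |s| ≤ π → |t| ≤ π → |s| < |t| → g t ≤ g s) :
    ∃ a, 0 ≤ a ∧ a ≤ π ∧ ∀ t, |t| ≤ π → (|t| < a → 0 ≤ g t) ∧ (a < |t| → g t ≤ 0) := by
  set S : Set ℝ := {u | 0 ≤ u ∧ u ≤ π ∧ ∃ t, |t| = u ∧ 0 ≤ g t} with hS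
  have hbdd : BddAbove S := ⟨π, fun u hu => hu.2.1⟩
  refine ⟨sSup S, Real.sSup_nonneg fun u hu => hu.1, Real.sSup_le (fun u hu => hu.2.1) pi_pos.le,
    fun t ht => ⟨fun hlt => ?_, fun hlt => ?_⟩⟩
  · have hne : S.Nonempty := by
      by_contra hne
      rw [not_nonempty_iff_eq_empty] at hne
      rw [hne, Real.sSup_empty] at hlt
      exact absurd hlt (abs_nonneg t).not_gt
    obtain ⟨u, ⟨-, hu, s, rfl, hs⟩, htu⟩ := exists_lt_of_lt_csSup hne hlt
    exact hs.trans (h t s ht hu htu)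
  · by_contra hg
    push Not at hg
    exact absurd (le_csSup hbdd ⟨abs_nonneg t, ht, t, rfl, hg.le⟩) hlt.not_ge

/-- A kernel which is a strictly increasing function of the cosine, with three successive periodic
primitives. -/
structure KernelChain (E U W V : ℝ → ℝ) : Prop where
  cont : Continuous E
  lt : ∀ s t, Real.cos s < Real.cos t → E s < E t
  eq : ∀ s t, Real.cos s = Real.cos t → E s = E t
  deriv_U : ∀ t, HasDerivAt U (E t) t
  deriv_W : ∀ t, HasDerivAt W (-U t) t
  deriv_V : ∀ t, HasDerivAt V (W t) t
  odd_U : ∀ t, U (-t) = -U t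
  odd_V : ∀ t, V (-t) = -V t
  per_U : Function.Periodic U (2 * π)
  per_V : Function.Periodic V (2 * π)
  mono_W : ∀ s t, Real.cos s ≤ Real.cos t → W s ≤ W t

namespace KernelChain

variable {E U W V Ψ : ℝ → ℝ} (h : KernelChain E U W V)
include h

lemma le (s t : ℝ) (hst : Real.cos s ≤ Real.cos t) : E s ≤ E t := by
  rcases hst.lt_or_eq with h1 | h1
  · exact (h.lt s t h1).le
  · exact (h.eq s t h1).le

lemma eq_W (s t : ℝ) (hst : Real.cos s = Real.cos t) : W s = W t :=
  le_antisymm (h.mono_W s t hst.le) (h.mono_W t s hst.ge)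

lemma cont_U : Continuous U := continuous_iff_continuousAt.2 fun t => (h.deriv_U t).continuousAt

lemma deriv_diff_U (a y : ℝ) :
    HasDerivAt (fun y => U (y + a) - U (y - a)) (E (y + a) - E (y - a)) y := by
  exact ((h.deriv_U (y + a)).comp_add_const y a).sub ((h.deriv_U (y - a)).comp_sub_const y a)

lemma deriv_diff_W (a y : ℝ) :
    HasDerivAt (fun y => W (y - a) - W (y + a)) (U (y + a) - U (y - a)) y := by
  have := ((h.deriv_W (y - a)).comp_sub_const y a).sub ((h.deriv_W (y + a)).comp_add_const y a)
  rw [neg_sub_neg] at this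
  exact this

lemma deriv_diff_V (a y : ℝ) :
    HasDerivAt (fun y => V (y - a) - V (y + a)) (W (y - a) - W (y + a)) y := by
  exact ((h.deriv_V (y - a)).comp_sub_const y a).sub ((h.deriv_V (y + a)).comp_add_const y a)

lemma integral_conv (hΨ : Continuous Ψ) (a : ℝ) :
    ∫ t in -a..a, ∫ y in -π..π, E (t - y) * Ψ y =
      ∫ y in -π..π, Ψ y * (U (y + a) - U (y - a)) := by
  have hE := h.cont
  have hF : Continuous (Function.uncurry fun t y => E (t - y) * Ψ y) := by
    unfold Function.uncurry; fun_prop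
  rw [intervalIntegral_intervalIntegral_swap ((hF.continuousOn.integrableOn_compact
    (isCompact_uIcc.prod isCompact_uIcc)).mono_set (prod_mono uIoc_subset_uIcc uIoc_subset_uIcc))]
  refine intervalIntegral.integral_congr fun y _ => ?_
  have h1 : ∫ t in -a..a, E (t - y) = U (a - y) - U (-a - y) :=
    intervalIntegral.integral_eq_sub_of_hasDerivAt
      (fun t _ => (h.deriv_U (t - y)).comp_sub_const t y)
      (Continuous.intervalIntegrable (by fun_prop) _ _)
  have h2 := h.odd_U (y - a)
  have h3 := h.odd_U (y + a)
  rw [neg_sub] at h2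
  rw [neg_add_rev, ← sub_eq_add_neg] at h3
  simp only [intervalIntegral.integral_mul_const, h1, h2, h3]
  ring

lemma integral_abs_conv (hΨ : Continuous Ψ)
    (hv : ∀ s t, |s| ≤ π → |t| ≤ π → |s| < |t| →
        (∫ y in -π..π, E (t - y) * Ψ y) ≤ ∫ y in -π..π, E (s - y) * Ψ y) :
    ∃ a, 0 ≤ a ∧ a ≤ π ∧ ∫ x in -π..π, |∫ y in -π..π, E (x - y) * Ψ y| =
      2 * ∫ y in (0)..π, (Ψ y + Ψ (-y)) * (U (y + a) - U (y - a)) := by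
  obtain ⟨a, ha0, haπ, ha⟩ := exists_sign_threshold hv
  refine ⟨a, ha0, haπ, ?_⟩
  have hE := h.cont
  have hU := h.cont_U
  set v : ℝ → ℝ := fun x => ∫ y in -π..π, E (x - y) * Ψ y with hvdef
  have hvc : Continuous v :=
    intervalIntegral.continuous_parametric_intervalIntegral_of_continuous' (by fun_prop) _ _
  have hi : ∀ a b, IntervalIntegrable v volume a b := fun a b => hvc.intervalIntegrable a b
  have hi' : ∀ a b, IntervalIntegrable (fun x => |v x|) volume a b :=
    fun a b => hvc.abs.intervalIntegrable a b
  have h1 : ∫ x in -π..-a, |v x| = -∫ x in -π..-a, v x := by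
    rw [← intervalIntegral.integral_neg]
    refine intervalIntegral.integral_congr_Ioo_of_le (by linarith) fun x hx => ?_
    have hx' : |x| = -x := abs_of_neg (by linarith [hx.2])
    exact abs_of_nonpos ((ha x (by linarith [hx.1])).2 (by linarith [hx.2]))
  have h2 : ∫ x in -a..a, |v x| = ∫ x in -a..a, v x := by
    refine intervalIntegral.integral_congr_Ioo_of_le (by linarith) fun x hx => ?_
    have hx' : |x| < a := abs_lt.2 hx
    exact abs_of_nonneg ((ha x (by linarith)).1 hx')
  have h3 : ∫ x in a..π, |v x| = -∫ x in a..π, v x := by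
    rw [← intervalIntegral.integral_neg]
    refine intervalIntegral.integral_congr_Ioo_of_le (by linarith) fun x hx => ?_
    have hx' : |x| = x := abs_of_pos (by linarith [hx.1])
    exact abs_of_nonpos ((ha x (by linarith [hx.2])).2 (by linarith [hx.1]))
  have h0 : ∫ x in -π..π, v x = 0 := by
    rw [h.integral_conv hΨ π]
    refine (intervalIntegral.integral_congr fun y _ => ?_).trans intervalIntegral.integral_zero
    have := h.per_U (y - π)
    rw [show y - π + 2 * π = y + π by ring] at this
    simp [this]
  have hz : ∫ x in -a..a, v x = ∫ y in (0)..π, (Ψ y + Ψ (-y)) * (U (y + a) - U (y - a)) := by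
    rw [h.integral_conv hΨ a, ← intervalIntegral.integral_add_adjacent_intervals (b := 0)
      (Continuous.intervalIntegrable (by fun_prop) _ _)
      (Continuous.intervalIntegrable (by fun_prop) _ _)]
    have := intervalIntegral.integral_comp_neg (a := 0) (b := π)
      (fun y => Ψ y * (U (y + a) - U (y - a)))
    rw [neg_zero] at this
    rw [← this, ← intervalIntegral.integral_add
      (Continuous.intervalIntegrable (by fun_prop) _ _)
      (Continuous.intervalIntegrable (by fun_prop) _ _)]
    refine intervalIntegral.integral_congr fun y _ => ?_
    have e1 := h.odd_U (y + a)
    have e2 := h.odd_U (y - a)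
    rw [neg_add'] at e1
    rw [neg_sub'] at e2
    simp only [sub_neg_eq_add] at e2
    simp only [e1, e2]
    ring
  rw [← hz, ← intervalIntegral.integral_add_adjacent_intervals (hi' (-π) (-a)) (hi' (-a) π),
    ← intervalIntegral.integral_add_adjacent_intervals (hi' (-a) a) (hi' a π), h1, h2, h3]
  rw [← intervalIntegral.integral_add_adjacent_intervals (hi (-π) (-a)) (hi (-a) π),
    ← intervalIntegral.integral_add_adjacent_intervals (hi (-a) a) (hi a π)] at h0
  linarith

lemma exists_threshold {a : ℝ} (ha0 : 0 ≤ a) (haπ : a ≤ π) :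
    ∃ b, 0 ≤ b ∧ b ≤ π ∧ ∀ y, 0 < y → y < π →
      (y < b → 0 ≤ U (y + a) - U (y - a)) ∧ (b < y → U (y + a) - U (y - a) ≤ 0) := by
  have hanti : AntitoneOn (fun y => U (y + a) - U (y - a)) (Icc 0 π) := by
    refine antitoneOn_of_deriv_nonpos (convex_Icc 0 π)
      (fun y _ => (h.deriv_diff_U a y).continuousAt.continuousWithinAt)
      (fun y _ => (h.deriv_diff_U a y).differentiableAt.differentiableWithinAt) fun y hy => ?_
    rw [interior_Icc] at hy
    rw [(h.deriv_diff_U a y).deriv, sub_nonpos]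
    refine h.le _ _ ?_
    rw [Real.cos_add, Real.cos_sub]
    have := mul_nonneg (Real.sin_pos_of_mem_Ioo hy).le (Real.sin_nonneg_of_nonneg_of_le_pi ha0 haπ)
    linarith
  obtain ⟨b, hb0, hbπ, hb⟩ := exists_sign_threshold (g := fun y => U (|y| + a) - U (|y| - a))
    fun s t hs ht hst => hanti ⟨abs_nonneg s, hs⟩ ⟨abs_nonneg t, ht⟩ hst.le
  refine ⟨b, hb0, hbπ, fun y hy hy' => ?_⟩
  have := hb y
  rw [abs_of_pos hy] at this
  exact this hy'.le

lemma integral_diff_U (a c d : ℝ) : ∫ y in c..d, (U (y + a) - U (y - a)) =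
    (W (d - a) - W (d + a)) - (W (c - a) - W (c + a)) := by
  have hU := h.cont_U
  exact intervalIntegral.integral_eq_sub_of_hasDerivAt (fun y _ => h.deriv_diff_W a y)
    (Continuous.intervalIntegrable (by fun_prop) _ _)

lemma diff_W_zero (a : ℝ) : W (0 - a) - W (0 + a) = 0 := by
  rw [sub_eq_zero]
  refine h.eq_W _ _ ?_
  rw [zero_sub, zero_add, Real.cos_neg]

lemma diff_W_pi (a : ℝ) : W (π - a) - W (π + a) = 0 := by
  rw [sub_eq_zero]
  refine h.eq_W _ _ ?_
  rw [Real.cos_pi_sub, add_comm, Real.cos_add_pi]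

lemma integral_mul_diff_le_of_bound {a M : ℝ} (ha0 : 0 ≤ a) (haπ : a ≤ π) (hΨ : Continuous Ψ)
    (hM : ∀ t, |Ψ t| ≤ M) :
    ∫ y in (0)..π, (Ψ y + Ψ (-y)) * (U (y + a) - U (y - a)) ≤ 4 * M * (W 0 - W π) := by
  obtain ⟨b, hb0, hbπ, hb⟩ := h.exists_threshold ha0 haπ
  have hU := h.cont_U
  have hM0 : 0 ≤ M := (abs_nonneg _).trans (hM 0)
  have hψ : ∀ y, |Ψ y + Ψ (-y)| ≤ 2 * M := fun y =>
    (abs_add_le _ _).trans (by linarith [hM y, hM (-y)])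
  have hi : ∀ c d, IntervalIntegrable (fun y => (Ψ y + Ψ (-y)) * (U (y + a) - U (y - a)))
    volume c d := fun c d => Continuous.intervalIntegrable (by fun_prop) _ _
  have hj : ∀ C c d, IntervalIntegrable (fun y => C * (U (y + a) - U (y - a)))
    volume c d := fun C c d => Continuous.intervalIntegrable (by fun_prop) _ _
  rw [← intervalIntegral.integral_add_adjacent_intervals (hi 0 b) (hi b π)]
  have h1 : ∫ y in (0)..b, (Ψ y + Ψ (-y)) * (U (y + a) - U (y - a)) ≤
      ∫ y in (0)..b, 2 * M * (U (y + a) - U (y - a)) := by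
    refine intervalIntegral.integral_mono_on_of_le_Ioo hb0 (hi _ _) (hj _ _ _) fun y hy => ?_
    have := (hb y hy.1 (hy.2.trans_le hbπ)).1 hy.2
    exact mul_le_mul_of_nonneg_right ((le_abs_self _).trans (hψ y)) this
  have h2 : ∫ y in b..π, (Ψ y + Ψ (-y)) * (U (y + a) - U (y - a)) ≤
      ∫ y in b..π, (-(2 * M)) * (U (y + a) - U (y - a)) := by
    refine intervalIntegral.integral_mono_on_of_le_Ioo hbπ (hi _ _) (hj _ _ _) fun y hy => ?_
    have := (hb y (hb0.trans_lt hy.1) hy.2).2 hy.1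
    exact mul_le_mul_of_nonpos_right (abs_le.1 (hψ y)).1 this
  rw [intervalIntegral.integral_const_mul, h.integral_diff_U, h.diff_W_zero] at h1
  rw [intervalIntegral.integral_const_mul, h.integral_diff_U, h.diff_W_pi] at h2
  have h3 : W (b - a) ≤ W 0 := h.mono_W _ _ (by rw [Real.cos_zero]; exact Real.cos_le_one _)
  have h4 : W π ≤ W (b + a) := h.mono_W _ _ (by rw [Real.cos_pi]; exact Real.neg_one_le_cos _)
  nlinarith

lemma add_V_le {a : ℝ} (ha0 : 0 ≤ a) (haπ : a ≤ π) : V a + V (π - a) ≤ 2 * V (π / 2) := by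
  wlog ha : a ≤ π / 2 generalizing a
  · have := this (a := π - a) (by linarith) (by linarith) (by linarith)
    rw [sub_sub_cancel] at this
    linarith
  have hd : ∀ y, HasDerivAt (fun y => V y + V (π - y)) (W y - W (π - y)) y := fun y =>
    (h.deriv_V y).add ((h.deriv_V (π - y)).comp_const_sub π y)
  have hmono : MonotoneOn (fun y => V y + V (π - y)) (Icc 0 (π / 2)) := by
    refine monotoneOn_of_deriv_nonneg (convex_Icc _ _)
      (fun y _ => (hd y).continuousAt.continuousWithinAt)
      (fun y _ => (hd y).differentiableAt.differentiableWithinAt) fun y hy => ?_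
    rw [interior_Icc] at hy
    rw [(hd y).deriv, sub_nonneg]
    exact h.mono_W _ _ (Real.cos_le_cos_of_nonneg_of_le_pi hy.1.le (by linarith [hy.1])
      (by linarith [hy.2]))
  have := hmono ⟨ha0, ha⟩ ⟨by positivity, le_rfl⟩ ha
  simp only [sub_half] at this
  linarith

lemma integral_sub_mul_diff_U (a b : ℝ) :
    ∫ y in (0)..π, (b - y) * (U (y + a) - U (y - a)) = 2 * (V a + V (π - a)) := by
  have hU := h.cont_U
  have hd : ∀ y, HasDerivAt (fun y => (b - y) * (W (y - a) - W (y + a)) + (V (y - a) - V (y + a)))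
      ((b - y) * (U (y + a) - U (y - a))) y := fun y => by
    have := (((hasDerivAt_id y).const_sub b).mul (h.deriv_diff_W a y)).add (h.deriv_diff_V a y)
    refine this.congr_deriv ?_
    simp only [id]
    ring
  have h2 := intervalIntegral.integral_eq_sub_of_hasDerivAt (fun y (_ : y ∈ uIcc 0 π) => hd y)
    (Continuous.intervalIntegrable (by fun_prop) _ _)
  have h3 : V (π + a) = -V (π - a) := by
    rw [← h.odd_V, ← h.per_V (-(π - a))]
    congr 1; ring
  rw [h2, h.diff_W_zero, h.diff_W_pi, h3, zero_sub, zero_add, h.odd_V]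
  ring

lemma integral_mul_diff_le_of_lipschitz {a L : ℝ} (ha0 : 0 ≤ a) (haπ : a ≤ π) (hL : 0 ≤ L)
    (hΨ : Continuous Ψ) (hLip : ∀ s t, |Ψ s - Ψ t| ≤ L * |s - t|) :
    ∫ y in (0)..π, (Ψ y + Ψ (-y)) * (U (y + a) - U (y - a)) ≤ 8 * L * V (π / 2) := by
  obtain ⟨b, hb0, hbπ, hb⟩ := h.exists_threshold ha0 haπ
  have hU := h.cont_U
  have hψ : ∀ y, |(Ψ y + Ψ (-y)) - (Ψ b + Ψ (-b))| ≤ 2 * L * |y - b| := fun y => by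
    have h1 := hLip y b
    have h2 := hLip (-y) (-b)
    rw [← neg_sub', abs_neg] at h2
    calc _ = |(Ψ y - Ψ b) + (Ψ (-y) - Ψ (-b))| := by congr 1; ring
      _ ≤ _ := (abs_add_le _ _).trans (by linarith)
  have h1 : ∫ y in (0)..π, (Ψ y + Ψ (-y)) * (U (y + a) - U (y - a)) ≤
      ∫ y in (0)..π, (2 * L * ((b - y) * (U (y + a) - U (y - a))) +
        (Ψ b + Ψ (-b)) * (U (y + a) - U (y - a))) := by
    refine intervalIntegral.integral_mono_on_of_le_Ioo pi_pos.le
      (Continuous.intervalIntegrable (by fun_prop) _ _)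
      (Continuous.intervalIntegrable (by fun_prop) _ _) fun y hy => ?_
    have hby := hb y hy.1 hy.2
    have hψy := abs_le.1 (hψ y)
    rcases lt_trichotomy y b with hyb | rfl | hyb
    · have := hby.1 hyb
      rw [abs_of_neg (by linarith)] at hψy
      nlinarith [mul_le_mul_of_nonneg_right hψy.2 this]
    · linarith
    · have := hby.2 hyb
      rw [abs_of_pos (by linarith)] at hψy
      nlinarith [mul_le_mul_of_nonpos_right hψy.1 this]
  rw [intervalIntegral.integral_add (Continuous.intervalIntegrable (by fun_prop) _ _)
    (Continuous.intervalIntegrable (by fun_prop) _ _), intervalIntegral.integral_const_mul,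
    intervalIntegral.integral_const_mul, h.integral_diff_U, h.diff_W_zero, h.diff_W_pi, h.integral_sub_mul_diff_U] at h1
  have h4 := h.add_V_le ha0 haπ
  nlinarith

end KernelChain

section
variable {E U W V Φ : ℝ → ℝ} {M L : ℝ}

lemma continuous_of_abs_sub_le (hLip : ∀ s t, |Φ s - Φ t| ≤ L * |s - t|) : Continuous Φ := by
  refine (LipschitzWith.of_dist_le_mul (K := L.toNNReal) fun s t => ?_).continuous
  rw [Real.dist_eq, Real.dist_eq]
  exact (hLip s t).trans (mul_le_mul_of_nonneg_right (Real.le_coe_toNNReal L) (abs_nonneg _))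

theorem KernelChain.integral_abs_le_of_bound (h : KernelChain E U W V) (hL : 0 ≤ L)
    (hper : Function.Periodic Φ (2 * π)) (hM : ∀ t, |Φ t| ≤ M)
    (hLip : ∀ s t, |Φ s - Φ t| ≤ L * |s - t|) :
    ∫ x in (0)..(2 * π), |∫ t in -π..π, Φ (x + t) * E t| ≤ 8 * M * (W 0 - W π) := by
  obtain ⟨Ψ, -, hΨM, hΨL, hle, hv⟩ :=
    exists_symmetric_maximizer hL h.cont h.lt h.eq hper hM hLip
  have hΨ := continuous_of_abs_sub_le hΨL
  obtain ⟨a, ha0, haπ, ha⟩ := h.integral_abs_conv hΨ hv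
  rw [ha] at hle
  linarith [h.integral_mul_diff_le_of_bound ha0 haπ hΨ hΨM]

theorem KernelChain.integral_abs_le_of_lipschitz (h : KernelChain E U W V) (hL : 0 ≤ L)
    (hper : Function.Periodic Φ (2 * π)) (hLip : ∀ s t, |Φ s - Φ t| ≤ L * |s - t|) :
    ∫ x in (0)..(2 * π), |∫ t in -π..π, Φ (x + t) * E t| ≤ 16 * L * V (π / 2) := by
  obtain ⟨M, hM⟩ : ∃ M, ∀ t, |Φ t| ≤ M := by
    obtain ⟨M, hM⟩ := (hper.compact_of_continuous Real.two_pi_pos.ne'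
      (continuous_of_abs_sub_le hLip)).isBounded.exists_norm_le
    exact ⟨M, fun t => hM _ (mem_range_self t)⟩
  obtain ⟨Ψ, -, hΨM, hΨL, hle, hv⟩ :=
    exists_symmetric_maximizer hL h.cont h.lt h.eq hper hM hLip
  have hΨ := continuous_of_abs_sub_le hΨL
  obtain ⟨a, ha0, haπ, ha⟩ := h.integral_abs_conv hΨ hv
  rw [ha] at hle
  linarith [h.integral_mul_diff_le_of_lipschitz ha0 haπ hL hΨ hΨL]

end

/-- The function `∑ ρ ^ k * sin (k t - m π / 2) / k ^ m`, an iterated primitive of the conjugate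
Poisson kernel. -/
def sinSum (ρ : ℝ) (m : ℕ) (t : ℝ) : ℝ :=
  ∑' k : ℕ, ρ ^ k * (Real.sin (k * t - m * (π / 2)) / (k : ℝ) ^ m)

section
variable {ρ : ℝ}

lemma abs_sin_div_pow_le (x : ℝ) (k m : ℕ) : |Real.sin x / (k : ℝ) ^ m| ≤ 1 := by
  rw [abs_div, abs_of_nonneg (by positivity : (0 : ℝ) ≤ (k : ℝ) ^ m)]
  rcases Nat.eq_zero_or_pos k with rfl | hk
  · rcases Nat.eq_zero_or_pos m with rfl | hm
    · simpa using Real.abs_sin_le_one x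
    · simp [hm.ne']
  · have h1 : (1 : ℝ) ≤ (k : ℝ) ^ m := one_le_pow₀ (by exact_mod_cast hk)
    exact div_le_one_of_le₀ ((Real.abs_sin_le_one x).trans h1) (by positivity)

lemma norm_sinSum_term_le (h0 : 0 ≤ ρ) (m k : ℕ) (t : ℝ) :
    ‖ρ ^ k * (Real.sin (k * t - m * (π / 2)) / (k : ℝ) ^ m)‖ ≤ ρ ^ k := by
  rw [norm_mul, Real.norm_of_nonneg (pow_nonneg h0 k)]
  exact mul_le_of_le_one_right (pow_nonneg h0 k) (abs_sin_div_pow_le _ _ _)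

lemma summable_sinSum (h0 : 0 ≤ ρ) (h1 : ρ < 1) (m : ℕ) (t : ℝ) :
    Summable fun k : ℕ => ρ ^ k * (Real.sin (k * t - m * (π / 2)) / (k : ℝ) ^ m) :=
  Summable.of_norm_bounded (summable_geometric_of_lt_one h0 h1)
    fun k => norm_sinSum_term_le h0 m k t

lemma hasDerivAt_sinSum_term (m k : ℕ) (t : ℝ) :
    HasDerivAt (fun t => ρ ^ k * (Real.sin (k * t - (m + 1 : ℕ) * (π / 2)) / (k : ℝ) ^ (m + 1)))
      (ρ ^ k * (Real.sin (k * t - m * (π / 2)) / (k : ℝ) ^ m)) t := by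
  have h := (((((hasDerivAt_id t).const_mul (k : ℝ)).sub_const ((m + 1 : ℕ) * (π / 2))).sin).div_const
    ((k : ℝ) ^ (m + 1))).const_mul (ρ ^ k)
  refine h.congr_deriv ?_
  rw [show (k : ℝ) * id t - (m + 1 : ℕ) * (π / 2) = (k * t - m * (π / 2)) - π / 2 by
    push_cast; simp only [id]; ring, Real.cos_sub_pi_div_two]
  rcases Nat.eq_zero_or_pos k with rfl | hk
  · rcases Nat.eq_zero_or_pos m with rfl | hm
    · simp
    · simp [hm.ne']
  · have : (k : ℝ) ≠ 0 := by positivity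
    field_simp
    ring

lemma hasDerivAt_sinSum (h0 : 0 ≤ ρ) (h1 : ρ < 1) (m : ℕ) (t : ℝ) :
    HasDerivAt (sinSum ρ (m + 1)) (sinSum ρ m t) t :=
  hasDerivAt_tsum (summable_geometric_of_lt_one h0 h1)
    (fun k y => hasDerivAt_sinSum_term m k y) (fun k y => norm_sinSum_term_le h0 m k y)
    (summable_sinSum h0 h1 (m + 1) 0) t

lemma continuous_sinSum (h0 : 0 ≤ ρ) (h1 : ρ < 1) (m : ℕ) : Continuous (sinSum ρ m) :=
  continuous_tsum (fun k => by fun_prop) (summable_geometric_of_lt_one h0 h1)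
    fun k t => norm_sinSum_term_le h0 m k t

lemma periodic_sinSum (ρ : ℝ) (m : ℕ) : Function.Periodic (sinSum ρ m) (2 * π) := fun t => by
  refine tsum_congr fun k => ?_
  rw [show (k : ℝ) * (t + 2 * π) - m * (π / 2) = k * t - m * (π / 2) + k * (2 * π) by ring,
    Real.sin_add_nat_mul_two_pi]

lemma sinSum_neg (ρ : ℝ) (m : ℕ) (t : ℝ) : sinSum ρ m (-t) = (-1) ^ (m + 1) * sinSum ρ m t := by
  rw [sinSum, sinSum, ← tsum_mul_left]
  refine tsum_congr fun k => ?_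
  rw [show (k : ℝ) * -t - m * (π / 2) = -((k * t - m * (π / 2)) + m * π) by ring, Real.sin_neg,
    Real.sin_add_nat_mul_pi]
  ring

lemma sinSum_zero_eq (h0 : 0 ≤ ρ) (h1 : ρ < 1) (t : ℝ) :
    sinSum ρ 0 t = ρ * Real.sin t / (1 - 2 * ρ * Real.cos t + ρ ^ 2) := by
  set z : ℂ := ρ * Complex.exp (t * Complex.I) with hz
  have hre : z.re = ρ * Real.cos t := by simp [hz, Complex.exp_ofReal_mul_I_re]
  have him : z.im = ρ * Real.sin t := by simp [hz, Complex.exp_ofReal_mul_I_im]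
  have hnorm : ‖z‖ < 1 := by
    rw [hz, norm_mul, Complex.norm_exp_ofReal_mul_I, mul_one, Complex.norm_real,
      Real.norm_of_nonneg h0]
    exact h1
  have h := Complex.hasSum_im (hasSum_geometric_of_norm_lt_one hnorm)
  have hterm : ∀ k : ℕ, (z ^ k).im =
      ρ ^ k * (Real.sin (k * t - (0 : ℕ) * (π / 2)) / (k : ℝ) ^ 0) := fun k => by
    rw [hz, mul_pow, ← Complex.exp_nat_mul, ← mul_assoc, ← Complex.ofReal_natCast,
      ← Complex.ofReal_mul, ← Complex.ofReal_pow, Complex.im_ofReal_mul, Complex.exp_ofReal_mul_I_im]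
    simp
  simp only [hterm] at h
  rw [sinSum, h.tsum_eq, Complex.inv_im]
  simp only [Complex.sub_im, Complex.one_im, Complex.normSq_apply, Complex.sub_re, Complex.one_re,
    hre, him]
  congr 1
  · ring
  · have := Real.sin_sq_add_cos_sq t
    linear_combination ρ ^ 2 * this

end

section
variable {ρ : ℝ}

lemma one_sub_cos_pos {t : ℝ} (h0 : 0 < t) (hπ : t ≤ π) : 0 < 1 - Real.cos t := by
  have := Real.cos_lt_cos_of_nonneg_of_le_pi le_rfl hπ h0
  rw [Real.cos_zero] at this
  linarith

lemma poisson_denom_pos (h0 : 0 ≤ ρ) (h1 : ρ < 1) (t : ℝ) :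
    0 < 1 - 2 * ρ * Real.cos t + ρ ^ 2 := by
  nlinarith [Real.cos_le_one t, sq_pos_of_pos (sub_pos.2 h1)]

lemma sinSum_zero_nonneg (h0 : 0 ≤ ρ) (h1 : ρ < 1) {t : ℝ} (ht0 : 0 ≤ t) (htπ : t ≤ π) :
    0 ≤ sinSum ρ 0 t := by
  rw [sinSum_zero_eq h0 h1]
  exact div_nonneg (mul_nonneg h0 (Real.sin_nonneg_of_nonneg_of_le_pi ht0 htπ))
    (poisson_denom_pos h0 h1 t).le

lemma sinSum_zero_le (h0 : 0 ≤ ρ) (h1 : ρ < 1) {t : ℝ} (ht0 : 0 < t) (htπ : t ≤ π) :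
    sinSum ρ 0 t ≤ Real.sin t / (2 * (1 - Real.cos t)) := by
  have hc := one_sub_cos_pos ht0 htπ
  rw [sinSum_zero_eq h0 h1, div_le_div_iff₀ (poisson_denom_pos h0 h1 t) (by positivity)]
  have hs := Real.sin_nonneg_of_nonneg_of_le_pi ht0.le htπ
  nlinarith [mul_nonneg hs (sq_nonneg (1 - ρ))]

lemma tendsto_sinSum_zero {t : ℝ} (ht0 : 0 < t) (htπ : t ≤ π) :
    Tendsto (fun ρ => sinSum ρ 0 t) (nhdsWithin 1 (Iio 1))
      (nhds (Real.sin t / (2 * (1 - Real.cos t)))) := by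
  have hc := one_sub_cos_pos ht0 htπ
  have h : ContinuousAt
      (fun ρ : ℝ => ρ * Real.sin t / (1 - 2 * ρ * Real.cos t + ρ ^ 2)) 1 := by
    refine ContinuousAt.div (by fun_prop) (by fun_prop) ?_
    nlinarith
  have h' := h.tendsto.mono_left (nhdsWithin_le_nhds (s := Iio 1))
  rw [one_mul, show 1 - 2 * 1 * Real.cos t + 1 ^ 2 = 2 * (1 - Real.cos t) by ring] at h'
  refine h'.congr' ?_
  filter_upwards [Ioo_mem_nhdsLT (zero_lt_one (α := ℝ))] with ρ hρ
  rw [sinSum_zero_eq hρ.1.le hρ.2]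

lemma sinSum_even_apply_pi (ρ : ℝ) (j : ℕ) : sinSum ρ (2 * j) π = 0 := by
  refine (tsum_congr fun k => ?_).trans tsum_zero
  rw [show (k : ℝ) * π - (2 * j : ℕ) * (π / 2) = ((k - j : ℤ) : ℝ) * π by push_cast; ring,
    Real.sin_int_mul_pi]
  simp

lemma sinSum_even_apply_zero (ρ : ℝ) (j : ℕ) : sinSum ρ (2 * j) 0 = 0 := by
  have := sinSum_neg ρ (2 * j) 0
  rw [neg_zero, Odd.neg_one_pow ⟨j, rfl⟩] at this
  linarith

/-- The kernel `∑ ρ ^ k * cos (k t) / k ^ (2 j + 1)`. -/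
def cosKernel (ρ : ℝ) (j : ℕ) (t : ℝ) : ℝ := (-1) ^ (j + 1) * sinSum ρ (2 * j + 1) t

/-- The kernel `∑ ρ ^ k * sin (k t) / k ^ (2 j + 2)`. -/
def sinKernel (ρ : ℝ) (j : ℕ) (t : ℝ) : ℝ := (-1) ^ (j + 1) * sinSum ρ (2 * j + 2) t

lemma hasDerivAt_sinKernel (h0 : 0 ≤ ρ) (h1 : ρ < 1) (j : ℕ) (t : ℝ) :
    HasDerivAt (sinKernel ρ j) (cosKernel ρ j t) t :=
  (hasDerivAt_sinSum h0 h1 (2 * j + 1) t).const_mul _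

lemma hasDerivAt_cosKernel_succ (h0 : 0 ≤ ρ) (h1 : ρ < 1) (j : ℕ) (t : ℝ) :
    HasDerivAt (cosKernel ρ (j + 1)) (-sinKernel ρ j t) t := by
  refine ((hasDerivAt_sinSum h0 h1 (2 * j + 2) t).const_mul _).congr_deriv ?_
  rw [sinKernel]; ring

lemma continuous_cosKernel (h0 : 0 ≤ ρ) (h1 : ρ < 1) (j : ℕ) : Continuous (cosKernel ρ j) :=
  continuous_const.mul (continuous_sinSum h0 h1 _)

lemma continuous_sinKernel (h0 : 0 ≤ ρ) (h1 : ρ < 1) (j : ℕ) : Continuous (sinKernel ρ j) :=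
  continuous_const.mul (continuous_sinSum h0 h1 _)

lemma periodic_cosKernel (ρ : ℝ) (j : ℕ) : Function.Periodic (cosKernel ρ j) (2 * π) := fun t => by
  rw [cosKernel, cosKernel, periodic_sinSum]

lemma periodic_sinKernel (ρ : ℝ) (j : ℕ) : Function.Periodic (sinKernel ρ j) (2 * π) := fun t => by
  rw [sinKernel, sinKernel, periodic_sinSum]

lemma cosKernel_neg (ρ : ℝ) (j : ℕ) (t : ℝ) : cosKernel ρ j (-t) = cosKernel ρ j t := by
  rw [cosKernel, cosKernel, sinSum_neg, Even.neg_one_pow (n := 2 * j + 1 + 1) ⟨j + 1, by ring⟩, one_mul]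

lemma sinKernel_neg (ρ : ℝ) (j : ℕ) (t : ℝ) : sinKernel ρ j (-t) = -sinKernel ρ j t := by
  rw [sinKernel, sinKernel, sinSum_neg, Odd.neg_one_pow (n := 2 * j + 2 + 1) ⟨j + 1, by ring⟩]
  ring

lemma sinKernel_zero (ρ : ℝ) (j : ℕ) : sinKernel ρ j 0 = 0 := by
  rw [sinKernel, show 2 * j + 2 = 2 * (j + 1) by ring, sinSum_even_apply_zero, mul_zero]

lemma sinKernel_pi (ρ : ℝ) (j : ℕ) : sinKernel ρ j π = 0 := by
  rw [sinKernel, show 2 * j + 2 = 2 * (j + 1) by ring, sinSum_even_apply_pi, mul_zero]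

lemma pos_of_strictAnti_deriv {F G : ℝ → ℝ} (hd : ∀ t, HasDerivAt G (F t) t)
    (hF : StrictAntiOn F (Icc 0 π)) (h0 : G 0 = 0) (hπ : G π = 0) {t : ℝ} (ht0 : 0 < t)
    (htπ : t < π) : 0 < G t := by
  have hcc : StrictConcaveOn ℝ (Icc 0 π) G := by
    refine StrictAntiOn.strictConcaveOn_of_deriv (convex_Icc _ _)
      (fun y _ => (hd y).continuousAt.continuousWithinAt) ?_
    rw [interior_Icc, funext fun y => (hd y).deriv]
    exact hF.mono Ioo_subset_Icc_self
  have h1 : 0 < 1 - t / π := by rw [sub_pos, div_lt_one pi_pos]; exact htπ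
  have := hcc.2 (left_mem_Icc.2 pi_pos.le) (right_mem_Icc.2 pi_pos.le) pi_pos.ne
    h1 (div_pos ht0 pi_pos) (sub_add_cancel _ _)
  simp only [h0, hπ, smul_eq_mul, mul_zero, zero_add, div_mul_cancel₀ t pi_pos.ne',
    add_zero] at this
  exact this

lemma strictAntiOn_cosKernel (h0 : 0 < ρ) (h1 : ρ < 1) (j : ℕ) :
    StrictAntiOn (cosKernel ρ j) (Icc 0 π) := by
  induction j with
  | zero =>
    refine strictAntiOn_of_deriv_neg (convex_Icc _ _)
      (continuous_cosKernel h0.le h1 0).continuousOn fun t ht => ?_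
    rw [interior_Icc] at ht
    have hd : HasDerivAt (cosKernel ρ 0) _ t :=
      (hasDerivAt_sinSum h0.le h1 0 t).const_mul ((-1) ^ (0 + 1))
    rw [hd.deriv, sinSum_zero_eq h0.le h1]
    have := div_pos (mul_pos h0 (Real.sin_pos_of_mem_Ioo ht)) (poisson_denom_pos h0.le h1 t)
    linarith
  | succ j ih =>
    refine strictAntiOn_of_deriv_neg (convex_Icc _ _)
      (continuous_cosKernel h0.le h1 _).continuousOn fun t ht => ?_
    rw [interior_Icc] at ht
    rw [(hasDerivAt_cosKernel_succ h0.le h1 j t).deriv, neg_lt_zero]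
    exact pos_of_strictAnti_deriv (hasDerivAt_sinKernel h0.le h1 j) ih (sinKernel_zero ρ j)
      (sinKernel_pi ρ j) ht.1 ht.2

lemma cosKernel_arccos_cos (ρ : ℝ) (j : ℕ) (t : ℝ) :
    cosKernel ρ j (Real.arccos (Real.cos t)) = cosKernel ρ j t := by
  have hcos : Real.cos (Real.arccos (Real.cos t)) = Real.cos t :=
    Real.cos_arccos (Real.neg_one_le_cos t) (Real.cos_le_one t)
  obtain ⟨n, hn | hn⟩ := Real.cos_eq_cos_iff.1 hcos
  · have := (periodic_cosKernel ρ j).int_mul n (Real.arccos (Real.cos t))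
    rw [← this]
    congr 1; rw [eq_comm]; convert hn using 1; ring
  · have := (periodic_cosKernel ρ j).int_mul n (-Real.arccos (Real.cos t))
    rw [← cosKernel_neg, ← this]
    congr 1; rw [eq_comm]; convert hn using 1; ring

lemma cosKernel_lt (h0 : 0 < ρ) (h1 : ρ < 1) (j : ℕ) {s t : ℝ} (h : Real.cos s < Real.cos t) :
    cosKernel ρ j s < cosKernel ρ j t := by
  rw [← cosKernel_arccos_cos ρ j s, ← cosKernel_arccos_cos ρ j t]
  exact strictAntiOn_cosKernel h0 h1 j ⟨Real.arccos_nonneg _, Real.arccos_le_pi _⟩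
    ⟨Real.arccos_nonneg _, Real.arccos_le_pi _⟩
    (Real.strictAntiOn_arccos ⟨Real.neg_one_le_cos s, Real.cos_le_one s⟩
      ⟨Real.neg_one_le_cos t, Real.cos_le_one t⟩ h)

lemma cosKernel_congr (ρ : ℝ) (j : ℕ) {s t : ℝ} (h : Real.cos s = Real.cos t) :
    cosKernel ρ j s = cosKernel ρ j t := by
  rw [← cosKernel_arccos_cos ρ j s, h, cosKernel_arccos_cos ρ j t]

theorem kernelChain (h0 : 0 < ρ) (h1 : ρ < 1) (j : ℕ) :
    KernelChain (cosKernel ρ j) (sinKernel ρ j) (cosKernel ρ (j + 1)) (sinKernel ρ (j + 1)) where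
  cont := continuous_cosKernel h0.le h1 j
  lt _ _ h := cosKernel_lt h0 h1 j h
  eq _ _ h := cosKernel_congr ρ j h
  deriv_U := hasDerivAt_sinKernel h0.le h1 j
  deriv_W := hasDerivAt_cosKernel_succ h0.le h1 j
  deriv_V := hasDerivAt_sinKernel h0.le h1 (j + 1)
  odd_U := sinKernel_neg ρ j
  odd_V := sinKernel_neg ρ (j + 1)
  per_U := periodic_sinKernel ρ j
  per_V := periodic_sinKernel ρ (j + 1)
  mono_W s t h := by
    rcases h.lt_or_eq with h | h
    · exact (cosKernel_lt h0 h1 _ h).le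
    · exact (cosKernel_congr ρ _ h).le

lemma tendsto_sinSum (m : ℕ) (hm : 2 ≤ m) (t : ℝ) :
    Tendsto (fun ρ => sinSum ρ m t) (nhdsWithin 1 (Iio 1))
      (nhds (∑' k : ℕ, Real.sin (k * t - m * (π / 2)) / (k : ℝ) ^ m)) := by
  refine tendsto_tsum_of_dominated_convergence (bound := fun k : ℕ => 1 / (k : ℝ) ^ m)
    (Real.summable_one_div_nat_pow.2 hm) (fun k => ?_) ?_
  · have : Continuous fun ρ : ℝ => ρ ^ k * (Real.sin (k * t - m * (π / 2)) / (k : ℝ) ^ m) := by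
      fun_prop
    have h := (this.tendsto 1).mono_left (nhdsWithin_le_nhds (s := Iio 1))
    rwa [one_pow, one_mul] at h
  · filter_upwards [Ioo_mem_nhdsLT (zero_lt_one (α := ℝ))] with ρ hρ k
    rw [norm_mul, Real.norm_of_nonneg (pow_nonneg hρ.1.le k), norm_div,
      Real.norm_of_nonneg (by positivity : (0 : ℝ) ≤ (k : ℝ) ^ m)]
    refine (mul_le_of_le_one_left (by positivity) (pow_le_one₀ hρ.1.le hρ.2.le)).trans ?_
    exact div_le_div_of_nonneg_right (Real.abs_sin_le_one _) (by positivity)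

lemma tsum_odd_of_even_eq_zero {F : ℕ → ℝ} (hs : Summable F) (h : ∀ i, F (2 * i) = 0) :
    ∑' k, F k = ∑' i, F (2 * i + 1) := by
  rw [← tsum_even_add_odd (hs.comp_injective (mul_right_injective₀ two_ne_zero))
    (hs.comp_injective ((add_left_injective 1).comp (mul_right_injective₀ two_ne_zero))),
    tsum_congr h, tsum_zero, zero_add]

lemma summable_sin_div (m : ℕ) (hm : 2 ≤ m) (t : ℝ) :
    Summable fun k : ℕ => Real.sin (k * t - m * (π / 2)) / (k : ℝ) ^ m := by
  refine Summable.of_norm_bounded (Real.summable_one_div_nat_pow.2 hm) fun k => ?_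
  rw [norm_div, Real.norm_of_nonneg (by positivity : (0 : ℝ) ≤ (k : ℝ) ^ m)]
  exact div_le_div_of_nonneg_right (Real.abs_sin_le_one _) (by positivity)

lemma tendsto_sinKernel_pi_div_two (j : ℕ) :
    Tendsto (fun ρ => sinKernel ρ j (π / 2)) (nhdsWithin 1 (Iio 1))
      (nhds (∑' i : ℕ, (-1 : ℝ) ^ i / (2 * (i : ℝ) + 1) ^ (2 * j + 2))) := by
  have h := (tendsto_sinSum (2 * j + 2) (by omega) (π / 2)).const_mul ((-1) ^ (j + 1))
  have hterm : ∀ k : ℕ, Real.sin (k * (π / 2) - (2 * j + 2 : ℕ) * (π / 2)) =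
      (-1) ^ (j + 1) * Real.sin (k * (π / 2)) := fun k => by
    rw [← Real.sin_sub_nat_mul_pi]
    congr 1; push_cast; ring
  convert h using 2
  · rfl
  rw [tsum_odd_of_even_eq_zero (summable_sin_div (2 * j + 2) (by omega) (π / 2)), ← tsum_mul_left]
  · refine tsum_congr fun i => ?_
    have : Real.sin ((2 * i + 1 : ℕ) * (π / 2)) = (-1) ^ i := by
      rw [← Real.cos_nat_mul_pi, ← Real.sin_add_pi_div_two]
      congr 1; push_cast; ring
    rw [hterm, this, ← mul_div_assoc, ← mul_assoc, ← mul_pow]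
    simp
  · intro i
    have : Real.sin ((2 * i : ℕ) * (π / 2)) = 0 := by
      rw [← Real.sin_nat_mul_pi i]
      congr 1; push_cast; ring
    rw [hterm, this]
    simp

lemma tendsto_cosKernel_zero_sub_pi (j : ℕ) (hj : 1 ≤ j) :
    Tendsto (fun ρ => cosKernel ρ j 0 - cosKernel ρ j π) (nhdsWithin 1 (Iio 1))
      (nhds (2 * ∑' i : ℕ, 1 / (2 * (i : ℝ) + 1) ^ (2 * j + 1))) := by
  have h := ((tendsto_sinSum (2 * j + 1) (by omega) 0).const_mul ((-1) ^ (j + 1))).sub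
    ((tendsto_sinSum (2 * j + 1) (by omega) π).const_mul ((-1) ^ (j + 1)))
  have hterm : ∀ x : ℝ, Real.sin (x - (2 * j + 1 : ℕ) * (π / 2)) =
      (-1) ^ (j + 1) * Real.cos x := fun x => by
    rw [show x - (2 * j + 1 : ℕ) * (π / 2) = x - j * π - π / 2 by push_cast; ring,
      Real.sin_sub_pi_div_two, Real.cos_sub_nat_mul_pi]
    ring
  convert h using 2
  · rfl
  have hs0 := summable_sin_div (2 * j + 1) (by omega) 0
  have hsπ := summable_sin_div (2 * j + 1) (by omega) π
  rw [← mul_sub, ← hs0.tsum_sub hsπ, tsum_odd_of_even_eq_zero (hs0.sub hsπ), ← tsum_mul_left,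
    ← tsum_mul_left]
  · refine tsum_congr fun i => ?_
    rw [hterm, hterm, mul_zero, Real.cos_zero, Real.cos_nat_mul_pi, Odd.neg_one_pow ⟨i, rfl⟩,
      ← sub_div, ← mul_sub, mul_div_assoc ((-1) ^ (j + 1)), ← mul_assoc, ← mul_pow]
    norm_num
    ring
  · intro i
    rw [hterm, hterm, mul_zero, Real.cos_zero, Real.cos_nat_mul_pi, Even.neg_one_pow ⟨i, two_mul i⟩,
      sub_self]

end

/-- The kernel `cot (t / 2) / 2` of the conjugate function. -/
def conjKernel (t : ℝ) : ℝ := Real.sin t / (2 * (1 - Real.cos t))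

/-- The conjugate function, with the principal value taken by symmetrization. -/
def conjugate (f : ℝ → ℝ) (x : ℝ) : ℝ :=
  -(1 / π) * ∫ t in (0)..π, (f (x + t) - f (x - t)) * conjKernel t

/-- The conjugate Poisson integral. -/
def conjPoisson (ρ : ℝ) (f : ℝ → ℝ) (x : ℝ) : ℝ :=
  -(1 / π) * ∫ t in -π..π, f (x + t) * sinSum ρ 0 t

lemma conjKernel_neg (t : ℝ) : conjKernel (-t) = -conjKernel t := by
  rw [conjKernel, conjKernel, Real.sin_neg, Real.cos_neg, neg_div]

lemma div_two_mul_tan (y t : ℝ) : y / (2 * Real.tan (t / 2)) = y * conjKernel t := by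
  have h1 : Real.sin t = 2 * Real.sin (t / 2) * Real.cos (t / 2) := by
    rw [← Real.sin_two_mul]; congr 1; ring
  have h2 : Real.cos t = 1 - 2 * Real.sin (t / 2) ^ 2 := by
    have h3 := Real.cos_sq' (t / 2)
    have h4 := Real.cos_two_mul (t / 2)
    rw [show 2 * (t / 2) = t by ring] at h4
    linarith
  rw [conjKernel, h1, h2, Real.tan_eq_sin_div_cos]
  rcases eq_or_ne (Real.sin (t / 2)) 0 with hs | hs
  · simp [hs]
  rcases eq_or_ne (Real.cos (t / 2)) 0 with hc | hc
  · simp [hc]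
  have : 1 - (1 - 2 * Real.sin (t / 2) ^ 2) ≠ 0 := by
    rw [sub_sub_cancel]; positivity
  field_simp
  ring

lemma conjKernel_nonneg {t : ℝ} (h0 : 0 < t) (hπ : t ≤ π) : 0 ≤ conjKernel t :=
  div_nonneg (Real.sin_nonneg_of_nonneg_of_le_pi h0.le hπ)
    (mul_nonneg two_pos.le (one_sub_cos_pos h0 hπ).le)

lemma mul_conjKernel_le_one {t : ℝ} (h0 : 0 < t) (hπ : t ≤ π) : t * conjKernel t ≤ 1 := by
  rcases hπ.lt_or_eq with h | rfl
  · have ht : t / 2 < Real.tan (t / 2) := Real.lt_tan (by linarith) (by linarith)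
    rw [← div_two_mul_tan, div_le_one (by linarith)]
    linarith
  · simp [conjKernel]

lemma continuousAt_conjKernel {t : ℝ} (h : Real.cos t ≠ 1) : ContinuousAt conjKernel t := by
  unfold conjKernel
  refine ContinuousAt.div (by fun_prop) (by fun_prop) (mul_ne_zero two_ne_zero ?_)
  exact sub_ne_zero.2 h.symm

lemma cos_ne_one {t : ℝ} (h0 : 0 < t) (hπ : t ≤ π) : Real.cos t ≠ 1 := by
  have := one_sub_cos_pos h0 hπ
  linarith

section
variable {f : ℝ → ℝ} {L : ℝ}

lemma abs_symm_diff_le (hLip : ∀ s t, |f s - f t| ≤ L * |s - t|) (x : ℝ) {t : ℝ} (h0 : 0 < t) :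
    |f (x + t) - f (x - t)| ≤ 2 * L * t := by
  have := hLip (x + t) (x - t)
  rw [show x + t - (x - t) = 2 * t by ring, abs_of_pos (by linarith : 0 < 2 * t)] at this
  linarith

lemma abs_symm_diff_mul_le (hL : 0 ≤ L) (hLip : ∀ s t, |f s - f t| ≤ L * |s - t|) (x : ℝ) {t κ : ℝ}
    (h0 : 0 < t) (hπ : t ≤ π) (hκ0 : 0 ≤ κ) (hκ : κ ≤ conjKernel t) :
    |(f (x + t) - f (x - t)) * κ| ≤ 2 * L := by
  rw [abs_mul, abs_of_nonneg hκ0]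
  calc _ ≤ 2 * L * t * conjKernel t :=
        mul_le_mul (abs_symm_diff_le hLip x h0) hκ hκ0 (by positivity)
    _ = 2 * L * (t * conjKernel t) := by ring
    _ ≤ 2 * L * 1 := mul_le_mul_of_nonneg_left (mul_conjKernel_le_one h0 hπ) (by positivity)
    _ = 2 * L := mul_one _

lemma measurable_conjKernel : Measurable conjKernel := by
  unfold conjKernel; fun_prop

lemma integrableOn_conjugate (hL : 0 ≤ L) (hLip : ∀ s t, |f s - f t| ≤ L * |s - t|) (x : ℝ) :
    IntegrableOn (fun t => (f (x + t) - f (x - t)) * conjKernel t) (Ioc 0 π) := by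
  have hf := continuous_of_abs_sub_le hLip
  refine Measure.integrableOn_of_bounded (M := 2 * L) measure_Ioc_lt_top.ne ?_ ?_
  · exact ((Continuous.measurable (by fun_prop)).mul measurable_conjKernel).aestronglyMeasurable
  · refine (ae_restrict_iff' measurableSet_Ioc).2 (ae_of_all _ fun t ht => ?_)
    exact abs_symm_diff_mul_le hL hLip x ht.1 ht.2 (conjKernel_nonneg ht.1 ht.2) le_rfl

lemma setIntegral_truncated (hf : Continuous f) (x : ℝ) {δ : ℝ} (hδ : 0 < δ) (hδπ : δ < π) :
    ∫ t in {t : ℝ | δ ≤ |t - x| ∧ |t - x| ≤ π}, f t / (2 * Real.tan ((t - x) / 2)) =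
      ∫ t in δ..π, (f (x + t) - f (x - t)) * conjKernel t := by
  have hset : {t : ℝ | δ ≤ |t - x| ∧ |t - x| ≤ π} = Icc (x - π) (x - δ) ∪ Icc (x + δ) (x + π) := by
    ext t
    rw [mem_union, mem_Icc, mem_Icc]
    change (δ ≤ |t - x| ∧ |t - x| ≤ π) ↔ _
    rw [le_abs, abs_le]
    constructor
    · rintro ⟨h | h, h1, h2⟩
      · right; constructor <;> linarith
      · left; constructor <;> linarith
    · rintro (⟨h1, h2⟩ | ⟨h1, h2⟩)
      · exact ⟨Or.inr (by linarith), by linarith, by linarith⟩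
      · exact ⟨Or.inl (by linarith), by linarith, by linarith⟩
  have hcont : ∀ t, δ ≤ |t - x| → |t - x| ≤ π → ContinuousAt (fun t => f t * conjKernel (t - x)) t := by
    intro t h1 h2
    refine hf.continuousAt.mul (ContinuousAt.comp (continuousAt_conjKernel ?_) (by fun_prop))
    rw [← Real.cos_abs]
    exact cos_ne_one (hδ.trans_le h1) h2
  have hc1 : ContinuousOn (fun t => f t * conjKernel (t - x)) (Icc (x - π) (x - δ)) := fun t ht =>
    (hcont t (le_abs.2 (Or.inr (by linarith [ht.2])))
      (abs_le.2 ⟨by linarith [ht.1], by linarith [ht.2]⟩)).continuousWithinAt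
  have hc2 : ContinuousOn (fun t => f t * conjKernel (t - x)) (Icc (x + δ) (x + π)) := fun t ht =>
    (hcont t (le_abs.2 (Or.inl (by linarith [ht.1])))
      (abs_le.2 ⟨by linarith [ht.1], by linarith [ht.2]⟩)).continuousWithinAt
  simp only [div_two_mul_tan]
  rw [hset, setIntegral_union _ measurableSet_Icc hc1.integrableOn_Icc hc2.integrableOn_Icc,
    integral_Icc_eq_integral_Ioc, integral_Icc_eq_integral_Ioc,
    ← intervalIntegral.integral_of_le (by linarith), ← intervalIntegral.integral_of_le (by linarith),
    ← intervalIntegral.integral_comp_add_left (fun t => f t * conjKernel (t - x)) x,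
    ← intervalIntegral.integral_comp_sub_left (fun t => f t * conjKernel (t - x)) x,
    ← intervalIntegral.integral_add]
  · refine intervalIntegral.integral_congr fun t _ => ?_
    simp only [add_sub_cancel_left, sub_sub_cancel_left, conjKernel_neg]
    ring
  · refine ContinuousOn.intervalIntegrable_of_Icc hδπ.le (hc1.comp (by fun_prop) fun t ht => ?_)
    exact ⟨by linarith [ht.2], by linarith [ht.1]⟩
  · refine ContinuousOn.intervalIntegrable_of_Icc hδπ.le (hc2.comp (by fun_prop) fun t ht => ?_)
    exact ⟨by linarith [ht.1], by linarith [ht.2]⟩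
  · refine Set.disjoint_left.2 fun t h1 h2 => ?_
    linarith [h1.2, h2.1]

theorem conjAt_conjugate (hL : 0 ≤ L) (hLip : ∀ s t, |f s - f t| ≤ L * |s - t|) (x : ℝ) :
    ConjAt f x (conjugate f x) := by
  have hf := continuous_of_abs_sub_le hLip
  have hInt := integrableOn_conjugate hL hLip x
  have hcont := intervalIntegral.continuousOn_primitive_interval_left (a := 0) (b := π)
    (f := fun t => (f (x + t) - f (x - t)) * conjKernel t) (μ := volume)
    (by rwa [uIcc_of_le pi_pos.le, integrableOn_Icc_iff_integrableOn_Ioc])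
  rw [uIcc_of_le pi_pos.le] at hcont
  have h0 : Tendsto (fun δ => ∫ t in δ..π, (f (x + t) - f (x - t)) * conjKernel t)
      (nhdsWithin 0 (Ioi 0)) (nhds (∫ t in (0)..π, (f (x + t) - f (x - t)) * conjKernel t)) := by
    refine (hcont 0 (left_mem_Icc.2 pi_pos.le)).tendsto.mono_left ?_
    rw [← nhdsWithin_Ioo_eq_nhdsGT pi_pos]
    exact nhdsWithin_mono _ Ioo_subset_Icc_self
  refine (h0.const_mul (-(1 / π))).congr' ?_
  filter_upwards [Ioo_mem_nhdsGT pi_pos] with δ hδ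
  rw [setIntegral_truncated hf x hδ.1 hδ.2]

lemma conjAt_unique {x a b : ℝ} (ha : ConjAt f x a) (hb : ConjAt f x b) : a = b :=
  tendsto_nhds_unique ha hb

variable {ρ : ℝ}

lemma conjPoisson_eq (h0 : 0 ≤ ρ) (h1 : ρ < 1) (hf : Continuous f) (x : ℝ) :
    conjPoisson ρ f x = -(1 / π) * ∫ t in (0)..π, (f (x + t) - f (x - t)) * sinSum ρ 0 t := by
  have hc := continuous_sinSum h0 h1 0
  have hodd : ∀ t, sinSum ρ 0 (-t) = -sinSum ρ 0 t := fun t => by rw [sinSum_neg]; ring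
  have := intervalIntegral.integral_comp_neg (a := 0) (b := π) (fun t => f (x + t) * sinSum ρ 0 t)
  rw [neg_zero] at this
  rw [conjPoisson, ← intervalIntegral.integral_add_adjacent_intervals (b := 0)
    (Continuous.intervalIntegrable (by fun_prop) _ _)
    (Continuous.intervalIntegrable (by fun_prop) _ _), ← this, ← intervalIntegral.integral_add
    (Continuous.intervalIntegrable (by fun_prop) _ _)
    (Continuous.intervalIntegrable (by fun_prop) _ _)]
  congr 1
  refine intervalIntegral.integral_congr fun t _ => ?_
  simp only [hodd, ← sub_eq_add_neg]
  ring

lemma abs_conjPoisson_le (h0 : 0 ≤ ρ) (h1 : ρ < 1) (hL : 0 ≤ L)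
    (hLip : ∀ s t, |f s - f t| ≤ L * |s - t|) (x : ℝ) : |conjPoisson ρ f x| ≤ 2 * L := by
  rw [conjPoisson_eq h0 h1 (continuous_of_abs_sub_le hLip), abs_mul, abs_neg,
    abs_of_pos (by positivity : 0 < 1 / π)]
  have := intervalIntegral.norm_integral_le_of_norm_le_const (a := 0) (b := π) (C := 2 * L)
    (f := fun t => (f (x + t) - f (x - t)) * sinSum ρ 0 t) fun t ht => by
      rw [uIoc_of_le pi_pos.le] at ht
      exact abs_symm_diff_mul_le hL hLip x ht.1 ht.2 (sinSum_zero_nonneg h0 h1 ht.1.le ht.2)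
        (sinSum_zero_le h0 h1 ht.1 ht.2)
  rw [sub_zero, abs_of_pos pi_pos, Real.norm_eq_abs] at this
  rw [one_div, inv_mul_le_iff₀ pi_pos]
  linarith

lemma tendsto_conjPoisson (hL : 0 ≤ L) (hLip : ∀ s t, |f s - f t| ≤ L * |s - t|) (x : ℝ) :
    Tendsto (fun ρ => conjPoisson ρ f x) (nhdsWithin 1 (Iio 1)) (nhds (conjugate f x)) := by
  have hf := continuous_of_abs_sub_le hLip
  have hev : ∀ᶠ ρ : ℝ in nhdsWithin 1 (Iio 1), ρ ∈ Ioo (0 : ℝ) 1 := Ioo_mem_nhdsLT zero_lt_one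
  have h : Tendsto (fun ρ => ∫ t in (0)..π, (f (x + t) - f (x - t)) * sinSum ρ 0 t)
      (nhdsWithin 1 (Iio 1)) (nhds (∫ t in (0)..π, (f (x + t) - f (x - t)) * conjKernel t)) := by
    refine intervalIntegral.tendsto_integral_filter_of_dominated_convergence (fun _ => 2 * L)
      ?_ ?_ intervalIntegrable_const ?_
    · filter_upwards [hev] with ρ hρ
      have hc := continuous_sinSum hρ.1.le hρ.2 0
      exact Continuous.aestronglyMeasurable (by fun_prop)
    · filter_upwards [hev] with ρ hρ
      refine ae_of_all _ fun t ht => ?_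
      rw [uIoc_of_le pi_pos.le] at ht
      exact abs_symm_diff_mul_le hL hLip x ht.1 ht.2
        (sinSum_zero_nonneg hρ.1.le hρ.2 ht.1.le ht.2) (sinSum_zero_le hρ.1.le hρ.2 ht.1 ht.2)
    · refine ae_of_all _ fun t ht => ?_
      rw [uIoc_of_le pi_pos.le] at ht
      exact (tendsto_sinSum_zero ht.1 ht.2).const_mul _
  refine (h.const_mul (-(1 / π))).congr' ?_
  filter_upwards [hev] with ρ hρ
  rw [conjPoisson_eq hρ.1.le hρ.2 hf]

lemma continuous_conjPoisson (h0 : 0 ≤ ρ) (h1 : ρ < 1) (hf : Continuous f) :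
    Continuous (conjPoisson ρ f) := by
  have hc := continuous_sinSum h0 h1 0
  exact continuous_const.mul
    (intervalIntegral.continuous_parametric_intervalIntegral_of_continuous' (by fun_prop) _ _)

theorem tendsto_integral_abs_conjPoisson (hL : 0 ≤ L) (hLip : ∀ s t, |f s - f t| ≤ L * |s - t|) :
    Tendsto (fun ρ => ∫ x in (0)..(2 * π), |conjPoisson ρ f x|) (nhdsWithin 1 (Iio 1))
      (nhds (∫ x in (0)..(2 * π), |conjugate f x|)) := by
  have hf := continuous_of_abs_sub_le hLip
  have hev : ∀ᶠ ρ : ℝ in nhdsWithin 1 (Iio 1), ρ ∈ Ioo (0 : ℝ) 1 := Ioo_mem_nhdsLT zero_lt_one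
  refine intervalIntegral.tendsto_integral_filter_of_dominated_convergence (fun _ => 2 * L)
    ?_ ?_ intervalIntegrable_const ?_
  · filter_upwards [hev] with ρ hρ
    exact (continuous_conjPoisson hρ.1.le hρ.2 hf).abs.aestronglyMeasurable
  · filter_upwards [hev] with ρ hρ
    refine ae_of_all _ fun t _ => ?_
    rw [Real.norm_eq_abs, abs_abs]
    exact abs_conjPoisson_le hρ.1.le hρ.2 hL hLip t
  · exact ae_of_all _ fun t _ => (tendsto_conjPoisson hL hLip t).abs

end

lemma integral_comp_add_of_periodic {g : ℝ → ℝ} (hg : Function.Periodic g (2 * π)) (a : ℝ) :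
    ∫ t in -π..π, g (t + a) = ∫ t in -π..π, g t := by
  rw [intervalIntegral.integral_comp_add_right, show π + a = -π + a + 2 * π by ring,
    hg.intervalIntegral_add_eq (-π + a) (-π), show -π + 2 * π = π by ring]

lemma exists_abs_le_of_periodic {g : ℝ → ℝ} (hg : Function.Periodic g (2 * π))
    (hc : Continuous g) : ∃ M, 0 ≤ M ∧ ∀ t, |g t| ≤ M := by
  obtain ⟨M, hM⟩ := (hg.compact_of_continuous Real.two_pi_pos.ne' hc).isBounded.exists_norm_le
  exact ⟨M, (norm_nonneg _).trans (hM _ (mem_range_self 0)), fun t => hM _ (mem_range_self t)⟩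

lemma integral_mul_deriv_of_periodic {F F' H H' : ℝ → ℝ} (hF : Function.Periodic F (2 * π))
    (hH : Function.Periodic H (2 * π)) (dF : ∀ t, HasDerivAt F (F' t) t)
    (dH : ∀ t, HasDerivAt H (H' t) t) (cF : Continuous F') (cH : Continuous H') (x : ℝ) :
    ∫ t in -π..π, F (x + t) * H' t = -∫ t in -π..π, F' (x + t) * H t := by
  rw [intervalIntegral.integral_mul_deriv_eq_deriv_mul
    (fun t _ => (dF (x + t)).comp_const_add x t) (fun t _ => dH t)
    (Continuous.intervalIntegrable (by fun_prop) _ _) (cH.intervalIntegrable _ _)]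
  have h1 := hF (x + -π)
  have h2 := hH (-π)
  rw [show x + -π + 2 * π = x + π by ring] at h1
  rw [show -π + 2 * π = π by ring] at h2
  rw [h1, h2]
  ring

lemma periodic_iteratedDeriv {f : ℝ → ℝ} (hf : Function.Periodic f (2 * π)) (n : ℕ) :
    Function.Periodic (iteratedDeriv n f) (2 * π) := fun t => by
  have := congrFun (iteratedDeriv_comp_add_const n f (2 * π)) t
  rw [← this]
  congr 1
  exact funext hf

lemma integral_mul_sinSum_eq {ρ : ℝ} (h0 : 0 ≤ ρ) (h1 : ρ < 1) {f : ℝ → ℝ}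
    (hf : Function.Periodic f (2 * π)) {n : ℕ} (hc : ContDiff ℝ n f) (x : ℝ) :
    ∫ t in -π..π, f (x + t) * sinSum ρ 0 t =
      (-1) ^ n * ∫ t in -π..π, iteratedDeriv n f (x + t) * sinSum ρ n t := by
  induction n with
  | zero => simp
  | succ n ih =>
    rw [ih (hc.of_le (by exact_mod_cast n.le_succ)), integral_mul_deriv_of_periodic
      (periodic_iteratedDeriv hf n) (periodic_sinSum ρ (n + 1)) (F' := iteratedDeriv (n + 1) f)
      (fun t => ?_) (fun t => hasDerivAt_sinSum h0 h1 n t)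
      (hc.continuous_iteratedDeriv (n + 1) le_rfl) (continuous_sinSum h0 h1 n)]
    · ring
    · rw [iteratedDeriv_succ]
      exact (hc.differentiable_iteratedDeriv n (by exact_mod_cast n.lt_succ_self) t).hasDerivAt

/-- If `Φ` is Lipschitz, its convolution with the derivative of the kernel of a chain is a limit of
convolutions of bounded functions with the kernel itself. -/
theorem KernelChain.integral_abs_le_of_deriv {E U W V T Φ : ℝ → ℝ} {K : ℝ}
    (h : KernelChain E U W V) (dE : ∀ t, HasDerivAt E (-T t) t) (cT : Continuous T)
    (pT : Function.Periodic T (2 * π)) (hK : 0 ≤ K) (hper : Function.Periodic Φ (2 * π))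
    (hLip : ∀ s t, |Φ s - Φ t| ≤ K * |s - t|) :
    ∫ x in (0)..(2 * π), |∫ t in -π..π, Φ (x + t) * T t| ≤ 8 * K * (W 0 - W π) := by
  have hΦ := continuous_of_abs_sub_le hLip
  have hE := h.cont
  have pE : Function.Periodic E (2 * π) := fun t => h.eq _ _ (Real.cos_periodic t)
  obtain ⟨B, hB0, hB⟩ := exists_abs_le_of_periodic pT cT
  obtain ⟨M, hM0, hM⟩ := exists_abs_le_of_periodic hper hΦ
  have hElip : ∀ s t, |E s - E t| ≤ B * |s - t| := fun s t =>
    Convex.norm_image_sub_le_of_norm_hasDerivWithin_le (s := univ)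
      (fun u _ => (dE u).hasDerivWithinAt) (fun u _ => by rw [norm_neg]; exact hB u) convex_univ
      (mem_univ t) (mem_univ s)
  set F : ℝ → ℝ → ℝ := fun ε x => ∫ t in -π..π, Φ (x + t) * ((E (t - ε) - E t) / ε) with hF
  have hFeq : ∀ ε x, F ε x = ∫ t in -π..π, ((Φ (x + t + ε) - Φ (x + t)) / ε) * E t := by
    intro ε x
    have hp : Function.Periodic (fun t => Φ (x + t) * E (t - ε)) (2 * π) := fun t => by
      beta_reduce
      rw [← add_assoc, hper, add_sub_right_comm, pE]
    have h1 := integral_comp_add_of_periodic hp ε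
    simp only [add_sub_cancel_right] at h1
    have h2 : F ε x = ((∫ t in -π..π, Φ (x + t) * E (t - ε)) -
        ∫ t in -π..π, Φ (x + t) * E t) / ε := by
      rw [← intervalIntegral.integral_sub (Continuous.intervalIntegrable (by fun_prop) _ _)
        (Continuous.intervalIntegrable (by fun_prop) _ _), ← intervalIntegral.integral_div]
      exact intervalIntegral.integral_congr fun t _ => by ring
    rw [h2, ← h1, ← intervalIntegral.integral_sub (Continuous.intervalIntegrable (by fun_prop) _ _)
        (Continuous.intervalIntegrable (by fun_prop) _ _), ← intervalIntegral.integral_div]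
    exact intervalIntegral.integral_congr fun t _ => by simp only [← add_assoc]; ring
  have hbd : ∀ ε, 0 < ε → ∫ x in (0)..(2 * π), |F ε x| ≤ 8 * K * (W 0 - W π) := by
    intro ε hε
    simp only [hFeq]
    refine h.integral_abs_le_of_bound (Φ := fun s => (Φ (s + ε) - Φ s) / ε) (L := 2 * K / ε)
      (by positivity) (fun s => ?_) (fun s => ?_) fun s t => ?_
    · beta_reduce
      rw [add_right_comm, hper, hper]
    · rw [abs_div, abs_of_pos hε, div_le_iff₀ hε]
      have := hLip (s + ε) s
      rwa [add_sub_cancel_left, abs_of_pos hε] at this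
    · rw [← sub_div, abs_div, abs_of_pos hε, div_mul_eq_mul_div]
      refine div_le_div_of_nonneg_right ?_ hε.le
      have h1 := hLip (s + ε) (t + ε)
      have h2 := hLip s t
      rw [add_sub_add_right_eq_sub] at h1
      calc _ = |(Φ (s + ε) - Φ (t + ε)) - (Φ s - Φ t)| := by congr 1; ring
        _ ≤ _ := (abs_sub _ _).trans (by linarith)
  have hq : ∀ ε t, 0 < ε → |(E (t - ε) - E t) / ε| ≤ B := by
    intro ε t hε
    rw [abs_div, abs_of_pos hε, div_le_iff₀ hε]
    have := hElip (t - ε) t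
    rwa [sub_sub_cancel_left, abs_neg, abs_of_pos hε] at this
  have hq' : ∀ ε x t, 0 < ε → ‖Φ (x + t) * ((E (t - ε) - E t) / ε)‖ ≤ M * B := by
    intro ε x t hε
    rw [norm_mul]
    exact mul_le_mul (hM _) (hq ε t hε) (abs_nonneg _) hM0
  have hpos : ∀ᶠ ε : ℝ in nhdsWithin 0 (Ioi 0), 0 < ε := self_mem_nhdsWithin
  have hlim : ∀ x, Tendsto (fun ε => F ε x) (nhdsWithin 0 (Ioi 0))
      (nhds (∫ t in -π..π, Φ (x + t) * T t)) := by
    intro x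
    refine intervalIntegral.tendsto_integral_filter_of_dominated_convergence (fun _ => M * B)
      (Eventually.of_forall fun ε => (Continuous.aestronglyMeasurable (by fun_prop)))
      (hpos.mono fun ε hε => ae_of_all _ fun t _ => hq' ε x t hε)
      intervalIntegrable_const (ae_of_all _ fun t _ => ?_)
    refine Tendsto.const_mul _ ?_
    have h1 : HasDerivAt (fun ε => E (t - ε)) (T t) 0 := by
      have : HasDerivAt E (-T t) (t - 0) := by rw [sub_zero]; exact dE t
      exact (this.comp_const_sub t 0).congr_deriv (neg_neg _)
    have h2 := hasDerivAt_iff_tendsto_slope_zero.1 h1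
    simp only [zero_add, sub_zero, smul_eq_mul] at h2
    refine (h2.mono_left (nhdsWithin_mono _ fun y hy => ne_of_gt hy)).congr fun ε => ?_
    rw [div_eq_inv_mul]
  have hmain : Tendsto (fun ε => ∫ x in (0)..(2 * π), |F ε x|) (nhdsWithin 0 (Ioi 0))
      (nhds (∫ x in (0)..(2 * π), |∫ t in -π..π, Φ (x + t) * T t|)) := by
    refine intervalIntegral.tendsto_integral_filter_of_dominated_convergence
      (fun _ => M * B * |π - -π|) (Eventually.of_forall fun ε => ?_)
      (hpos.mono fun ε hε => ae_of_all _ fun x _ => ?_)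
      intervalIntegrable_const (ae_of_all _ fun x _ => (hlim x).abs)
    · refine Continuous.aestronglyMeasurable (Continuous.abs ?_)
      exact intervalIntegral.continuous_parametric_intervalIntegral_of_continuous'
        (by fun_prop) _ _
    · rw [norm_eq_abs, abs_abs]
      exact intervalIntegral.norm_integral_le_of_norm_le_const fun t _ => hq' ε x t hε
  exact le_of_tendsto hmain (hpos.mono fun ε hε => hbd ε hε)

section
variable {Φ G Q : ℝ → ℝ}

lemma integral_convolution_eq (hΦ : Continuous Φ) (hG : Continuous G)
    (pΦ : Function.Periodic Φ (2 * π)) (pG : Function.Periodic G (2 * π))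
    (dQ : ∀ t, HasDerivAt Q (G t) t) (a b : ℝ) :
    ∫ x in a..b, ∫ t in -π..π, Φ (x + t) * G t =
      ∫ y in -π..π, Φ y * (Q (y - a) - Q (y - b)) := by
  have h1 : ∀ x, ∫ t in -π..π, Φ (x + t) * G t = ∫ y in -π..π, Φ y * G (y - x) := by
    intro x
    have hp : Function.Periodic (fun y => Φ y * G (y - x)) (2 * π) := fun y => by
      beta_reduce
      rw [pΦ, add_sub_right_comm, pG]
    rw [← integral_comp_add_of_periodic hp x]
    exact intervalIntegral.integral_congr fun t _ => by
      simp only [add_sub_cancel_right, add_comm x t]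
  simp only [h1]
  have hF : Continuous (Function.uncurry fun x y => Φ y * G (y - x)) := by
    unfold Function.uncurry; fun_prop
  rw [intervalIntegral_intervalIntegral_swap ((hF.continuousOn.integrableOn_compact
    (isCompact_uIcc.prod isCompact_uIcc)).mono_set (prod_mono uIoc_subset_uIcc uIoc_subset_uIcc))]
  refine intervalIntegral.integral_congr fun y _ => ?_
  have h2 : ∫ x in a..b, G (y - x) = -Q (y - b) - -Q (y - a) :=
    intervalIntegral.integral_eq_sub_of_hasDerivAt
      (fun x _ => ((dQ (y - x)).comp_const_sub y x).neg.congr_deriv (neg_neg _))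
      (Continuous.intervalIntegrable (by fun_prop) _ _)
  simp only [intervalIntegral.integral_const_mul, h2]
  ring

/-- Testing a mean zero convolution against the indicator function of an arc. -/
lemma two_mul_integral_le_integral_abs (hΦ : Continuous Φ) (hG : Continuous G)
    (pΦ : Function.Periodic Φ (2 * π)) (pG : Function.Periodic G (2 * π))
    (pQ : Function.Periodic Q (2 * π)) (dQ : ∀ t, HasDerivAt Q (G t) t) {c d : ℝ}
    (hcd : c ≤ d) (hdc : d ≤ c + 2 * π) :
    2 * ∫ y in -π..π, Φ y * (Q (y - c) - Q (y - d)) ≤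
      ∫ x in (0)..(2 * π), |∫ t in -π..π, Φ (x + t) * G t| := by
  set w : ℝ → ℝ := fun x => ∫ t in -π..π, Φ (x + t) * G t with hw
  have cw : Continuous w :=
    intervalIntegral.continuous_parametric_intervalIntegral_of_continuous' (by fun_prop) _ _
  have pw : Function.Periodic (fun x => |w x|) (2 * π) := fun x => by
    simp only [hw, add_right_comm x, pΦ _]
  have hi : ∀ a b, IntervalIntegrable w volume a b := fun a b => cw.intervalIntegrable a b
  have hi' : ∀ a b, IntervalIntegrable (fun x => |w x|) volume a b :=
    fun a b => cw.abs.intervalIntegrable a b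
  rw [← integral_convolution_eq hΦ hG pΦ pG dQ c d]
  have h0 : ∫ x in c..c + 2 * π, w x = 0 := by
    rw [hw, integral_convolution_eq hΦ hG pΦ pG dQ]
    refine (intervalIntegral.integral_congr fun y _ => ?_).trans intervalIntegral.integral_zero
    have := pQ (y - (c + 2 * π))
    rw [show y - (c + 2 * π) + 2 * π = y - c by ring] at this
    simp [this]
  have h1 := pw.intervalIntegral_add_eq 0 c
  rw [zero_add] at h1
  rw [h1, ← intervalIntegral.integral_add_adjacent_intervals (hi' c d) (hi' d _)]
  rw [← intervalIntegral.integral_add_adjacent_intervals (hi c d) (hi d _)] at h0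
  have h2 := intervalIntegral.integral_mono_on hcd (hi c d) (hi' c d) fun x _ => le_abs_self (w x)
  have h3 := intervalIntegral.integral_mono_on hdc (hi d _).neg (hi' d _)
    fun x _ => neg_le_abs (w x)
  simp only [Pi.neg_apply, intervalIntegral.integral_neg] at h3
  change 2 * ∫ x in c..d, w x ≤ _
  linarith

end

lemma integral_symm_of_even {g : ℝ → ℝ} (hg : Continuous g) (he : ∀ t, g (-t) = g t) (a : ℝ) :
    ∫ t in -a..a, g t = 2 * ∫ t in (0)..a, g t := by
  rw [← intervalIntegral.integral_add_adjacent_intervals (hg.intervalIntegrable (-a) 0)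
    (hg.intervalIntegrable 0 a)]
  have := intervalIntegral.integral_comp_neg (a := 0) (b := a) g
  simp only [he, neg_zero] at this
  rw [← this, two_mul]

/-- The even triangle wave with slopes `±1` and zero mean. -/
def triangleWave (t : ℝ) : ℝ := Real.arcsin (Real.cos t)

lemma continuous_triangleWave : Continuous triangleWave :=
  Real.continuous_arcsin.comp Real.continuous_cos

lemma periodic_triangleWave : Function.Periodic triangleWave (2 * π) := fun t => by
  rw [triangleWave, Real.cos_add_two_pi, triangleWave]

lemma triangleWave_neg (t : ℝ) : triangleWave (-t) = triangleWave t := by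
  rw [triangleWave, Real.cos_neg, triangleWave]

lemma triangleWave_eq {t : ℝ} (h0 : 0 ≤ t) (hπ : t ≤ π) : triangleWave t = π / 2 - t := by
  rw [triangleWave, Real.arcsin_eq_pi_div_two_sub_arccos, Real.arccos_cos h0 hπ]

lemma abs_triangleWave_sub_le (s t : ℝ) : |triangleWave s - triangleWave t| ≤ |s - t| := by
  have key : ∀ s t, Real.arccos (Real.cos s) ≤ |s - t| + Real.arccos (Real.cos t) := by
    intro s t
    obtain ⟨n, hn, -⟩ := existsUnique_sub_zsmul_mem_Ioc Real.two_pi_pos t (-π)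
    simp only [zsmul_eq_mul, mem_Ioc] at hn
    have h1 : Real.arccos (Real.cos t) = |t - n * (2 * π)| := by
      rw [← Real.cos_sub_int_mul_two_pi t n, ← Real.cos_abs, Real.arccos_cos (abs_nonneg _)]
      rw [abs_le]; constructor <;> linarith [hn.1, hn.2]
    have h2 := arccos_cos_le_abs (s - n * (2 * π))
    rw [Real.cos_sub_int_mul_two_pi] at h2
    rw [h1]
    exact h2.trans (abs_sub_le _ _ _)
  have h1 := key s t
  have h2 := key t s
  rw [abs_sub_comm] at h2
  rw [triangleWave, triangleWave, Real.arcsin_eq_pi_div_two_sub_arccos,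
    Real.arcsin_eq_pi_div_two_sub_arccos, abs_le]
  constructor <;> linarith

lemma integral_triangleWave : ∫ t in (0)..(2 * π), triangleWave t = 0 := by
  have h1 := periodic_triangleWave.intervalIntegral_add_eq 0 (-π)
  rw [zero_add, show -π + 2 * π = π by ring] at h1
  rw [h1, integral_symm_of_even continuous_triangleWave triangleWave_neg]
  have h2 : ∫ t in (0)..π, triangleWave t = ∫ t in (0)..π, (π / 2 - t) :=
    intervalIntegral.integral_congr_Ioo_of_le pi_pos.le fun t ht =>
      triangleWave_eq ht.1.le ht.2.le
  rw [h2, intervalIntegral.integral_comp_sub_left (fun t => t), integral_id]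
  ring

namespace KernelChain

variable {E U W V T : ℝ → ℝ} {K : ℝ} (h : KernelChain E U W V)
include h

theorem le_integral_abs_triangleWave :
    16 * K * V (π / 2) ≤
      ∫ x in (0)..(2 * π), |∫ t in -π..π, (K * triangleWave (x + t)) * E t| := by
  have hT := continuous_triangleWave
  have hU := h.cont_U
  have h1 := two_mul_integral_le_integral_abs (Φ := fun t => K * triangleWave t)
    (c := -(π / 2)) (d := π / 2) (by fun_prop) h.cont
    (fun t => by simp only [periodic_triangleWave t])
    (fun t => h.eq _ _ (Real.cos_periodic t)) h.per_U h.deriv_U (by linarith [pi_pos])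
    (by linarith [pi_pos])
  refine le_trans (le_of_eq ?_) h1
  rw [integral_symm_of_even (by fun_prop) fun t => ?_]
  · have h2 : ∫ t in (0)..π, K * triangleWave t * (U (t - -(π / 2)) - U (t - π / 2)) =
        ∫ t in (0)..π, K * ((π / 2 - t) * (U (t + π / 2) - U (t - π / 2))) :=
      intervalIntegral.integral_congr_Ioo_of_le pi_pos.le fun t ht => by
        simp only [triangleWave_eq ht.1.le ht.2.le, sub_neg_eq_add]; ring
    rw [h2, intervalIntegral.integral_const_mul, h.integral_sub_mul_diff_U, sub_half]
    ring
  · have e1 := h.odd_U (t + π / 2)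
    have e2 := h.odd_U (t - π / 2)
    rw [neg_add'] at e1
    rw [neg_sub', sub_neg_eq_add] at e2
    rw [triangleWave_neg, sub_neg_eq_add, sub_neg_eq_add, e1, e2]
    ring

theorem le_integral_abs_triangleWave_of_deriv (dE : ∀ t, HasDerivAt E (-T t) t)
    (cT : Continuous T) (pT : Function.Periodic T (2 * π)) :
    8 * K * (W 0 - W π) ≤
      ∫ x in (0)..(2 * π), |∫ t in -π..π, (K * triangleWave (x + t)) * T t| := by
  have hT := continuous_triangleWave
  have hE := h.cont
  have hU := h.cont_U
  have h1 := two_mul_integral_le_integral_abs (Φ := fun t => K * triangleWave t)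
    (Q := fun t => -E t) (c := -π) (d := 0) (by fun_prop) cT
    (fun t => by simp only [periodic_triangleWave t]) pT
    (fun t => by simp only [h.eq _ _ (Real.cos_periodic t)])
    (fun t => (dE t).neg.congr_deriv (neg_neg _)) (by linarith [pi_pos]) (by linarith [pi_pos])
  refine le_trans (le_of_eq ?_) h1
  have hπ : ∀ t, E (t - -π) = E (π - t) := fun t => h.eq _ _ (by
    rw [sub_neg_eq_add, Real.cos_add_pi, Real.cos_pi_sub])
  simp only [hπ, sub_zero]
  rw [integral_symm_of_even (by fun_prop) fun t => ?_]
  · have h2 : ∫ t in (0)..π, K * triangleWave t * (-E (π - t) - -E t) =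
        ∫ t in (0)..π, K * ((π / 2 - t) * (E t - E (π - t))) :=
      intervalIntegral.integral_congr_Ioo_of_le pi_pos.le fun t ht => by
        simp only [triangleWave_eq ht.1.le ht.2.le]; ring
    have hd : ∀ t, HasDerivAt (fun t => (π / 2 - t) * (U t + U (π - t)) + (W (π - t) - W t))
        ((π / 2 - t) * (E t - E (π - t))) t := fun t => by
      have := (((hasDerivAt_id t).const_sub (π / 2)).mul ((h.deriv_U t).add
        ((h.deriv_U (π - t)).comp_const_sub π t))).add
        (((h.deriv_W (π - t)).comp_const_sub π t).sub (h.deriv_W t))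
      refine this.congr_deriv ?_
      simp only [id, Pi.add_apply]
      ring
    have h3 := intervalIntegral.integral_eq_sub_of_hasDerivAt (fun t (_ : t ∈ uIcc 0 π) => hd t)
      (Continuous.intervalIntegrable (by fun_prop) _ _)
    have hU0 : U 0 = 0 := by
      have := h.odd_U 0
      rw [neg_zero] at this
      linarith
    have hUπ : U π = 0 := by
      have e1 := h.odd_U π
      have e2 := h.per_U (-π)
      rw [show -π + 2 * π = π by ring] at e2
      linarith
    rw [h2, intervalIntegral.integral_const_mul, h3]
    simp only [sub_self, sub_zero, hU0, hUπ]
    ring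
  · have e1 : E (π - -t) = E (π - t) := h.eq _ _ (by
      rw [Real.cos_pi_sub, Real.cos_pi_sub, Real.cos_neg])
    rw [triangleWave_neg, e1, h.eq (-t) t (Real.cos_neg t)]

end KernelChain

lemma abs_integral_mul_cosKernel (ρ : ℝ) (j : ℕ) (φ : ℝ → ℝ) :
    |∫ t in -π..π, φ t * cosKernel ρ j t| = |∫ t in -π..π, φ t * sinSum ρ (2 * j + 1) t| := by
  simp only [cosKernel, mul_left_comm _ ((-1 : ℝ) ^ (j + 1)), intervalIntegral.integral_const_mul]
  rw [abs_mul, abs_neg_one_pow, one_mul]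

lemma abs_integral_mul_sinKernel (ρ : ℝ) (j : ℕ) (φ : ℝ → ℝ) :
    |∫ t in -π..π, φ t * sinKernel ρ j t| = |∫ t in -π..π, φ t * sinSum ρ (2 * j + 2) t| := by
  simp only [sinKernel, mul_left_comm _ ((-1 : ℝ) ^ (j + 1)), intervalIntegral.integral_const_mul]
  rw [abs_mul, abs_neg_one_pow, one_mul]

/-- The sharp `L¹` bound for convolutions of Lipschitz functions with `sinSum ρ n`, and its limit
as `ρ → 1`. -/
theorem exists_sharp_constant {n : ℕ} (hn : 1 ≤ n) :
    ∃ A : ℝ → ℝ, Tendsto A (nhdsWithin 1 (Iio 1)) (nhds (16 * ∑' i : ℕ,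
        (-1 : ℝ) ^ (i * (n + 2)) / (2 * (i : ℝ) + 1) ^ (n + 3))) ∧
      ∀ ρ, 0 < ρ → ρ < 1 → ∀ K, 0 ≤ K →
        (∀ Φ : ℝ → ℝ, Function.Periodic Φ (2 * π) → (∀ s t, |Φ s - Φ t| ≤ K * |s - t|) →
          ∫ x in (0)..(2 * π), |∫ t in -π..π, Φ (x + t) * sinSum ρ n t| ≤ K * A ρ) ∧
        K * A ρ ≤
          ∫ x in (0)..(2 * π), |∫ t in -π..π, (K * triangleWave (x + t)) * sinSum ρ n t| := by
  rcases n.even_or_odd' with ⟨m, rfl | rfl⟩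
  · obtain ⟨m, rfl⟩ : ∃ k, m = k + 1 := ⟨m - 1, by omega⟩
    refine ⟨fun ρ => 8 * (cosKernel ρ (m + 2) 0 - cosKernel ρ (m + 2) π), ?_,
      fun ρ h0 h1 K hK => ?_⟩
    · have h := (tendsto_cosKernel_zero_sub_pi (m + 2) (by omega)).const_mul 8
      rw [← mul_assoc] at h
      convert h using 2
      norm_num
      refine tsum_congr fun i => ?_
      rw [Even.neg_one_pow (Even.mul_left ⟨m + 2, by ring⟩ i), one_div]
      congr 2
    · have h := kernelChain h0 h1 (m + 1)
      have dE := hasDerivAt_cosKernel_succ h0.le h1 m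
      simp only [mul_add_one, ← abs_integral_mul_sinKernel]
      refine ⟨fun Φ hper hLip => ?_, ?_⟩
      · linarith [h.integral_abs_le_of_deriv dE (continuous_sinKernel h0.le h1 m)
          (periodic_sinKernel ρ m) hK hper hLip]
      · linarith [h.le_integral_abs_triangleWave_of_deriv (K := K) dE
          (continuous_sinKernel h0.le h1 m) (periodic_sinKernel ρ m)]
  · refine ⟨fun ρ => 16 * sinKernel ρ (m + 1) (π / 2), ?_, fun ρ h0 h1 K hK => ?_⟩
    · have h := (tendsto_sinKernel_pi_div_two (m + 1)).const_mul 16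
      convert h using 6 with i
      · rw [mul_comm, pow_mul, Odd.neg_one_pow ⟨m + 1, by ring⟩]
      · congr 1
    · have h := kernelChain h0 h1 m
      simp only [← abs_integral_mul_cosKernel]
      refine ⟨fun Φ hper hLip => ?_, ?_⟩
      · linarith [h.integral_abs_le_of_lipschitz hK hper hLip]
      · linarith [h.le_integral_abs_triangleWave (K := K)]

lemma integral_abs_conjPoisson {ρ : ℝ} (h0 : 0 ≤ ρ) (h1 : ρ < 1) {f : ℝ → ℝ}
    (hf : Function.Periodic f (2 * π)) {n : ℕ} (hc : ContDiff ℝ n f) :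
    ∫ x in (0)..(2 * π), |conjPoisson ρ f x| =
      (1 / π) * ∫ x in (0)..(2 * π), |∫ t in -π..π, iteratedDeriv n f (x + t) * sinSum ρ n t| := by
  rw [← intervalIntegral.integral_const_mul]
  refine intervalIntegral.integral_congr fun x _ => ?_
  simp only [conjPoisson]
  rw [integral_mul_sinSum_eq h0 h1 hf hc, abs_mul, abs_mul, abs_neg, abs_neg_one_pow, one_mul,
    abs_of_pos (one_div_pos.2 pi_pos)]

/-- A periodic function of mean zero has periodic iterated primitives. -/
lemma exists_iteratedDeriv_eq {φ : ℝ → ℝ} (hφ : Continuous φ)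
    (hper : Function.Periodic φ (2 * π)) (h0 : ∫ x in (0)..(2 * π), φ x = 0) (n : ℕ) :
    ∃ f : ℝ → ℝ, Function.Periodic f (2 * π) ∧ ContDiff ℝ n f ∧ iteratedDeriv n f = φ ∧
      ∫ x in (0)..(2 * π), f x = 0 := by
  induction n with
  | zero => exact ⟨φ, hper, contDiff_zero.2 hφ, iteratedDeriv_zero, h0⟩
  | succ n ih =>
    obtain ⟨f, pf, cf, df, zf⟩ := ih
    have hf : Continuous f := cf.continuous
    set F : ℝ → ℝ := fun x => ∫ t in (0)..x, f t with hF
    set c : ℝ := (∫ x in (0)..(2 * π), F x) / (2 * π) with hc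
    have dF : ∀ x, HasDerivAt (fun x => F x - c) (f x) x := fun x =>
      (intervalIntegral.integral_hasDerivAt_right (hf.intervalIntegrable _ _)
        (hf.stronglyMeasurableAtFilter _ _) hf.continuousAt).sub_const c
    have dF' : deriv (fun x => F x - c) = f := funext fun x => (dF x).deriv
    have cF : Continuous F := intervalIntegral.continuous_primitive
      (fun a b => hf.intervalIntegrable a b) 0
    refine ⟨fun x => F x - c, fun x => ?_, ?_, ?_, ?_⟩
    · have h1 := intervalIntegral.integral_add_adjacent_intervals (μ := volume)
        (hf.intervalIntegrable 0 x) (hf.intervalIntegrable x (x + 2 * π))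
      have h2 := pf.intervalIntegral_add_eq x 0
      rw [zero_add, zf] at h2
      simp only [hF]
      rw [← h1, h2, add_zero]
    · push_cast
      refine contDiff_succ_iff_deriv.2 ⟨fun x => (dF x).differentiableAt, fun h => by simp at h, ?_⟩
      rwa [dF']
    · rw [iteratedDeriv_succ', dF', df]
    · rw [intervalIntegral.integral_sub (cF.intervalIntegrable _ _) intervalIntegrable_const,
        intervalIntegral.integral_const, hc, sub_zero, smul_eq_mul,
        mul_div_cancel₀ _ Real.two_pi_pos.ne', sub_self]

lemma exists_lipschitz_of_periodic {f : ℝ → ℝ} (hf : Function.Periodic f (2 * π)) {n : ℕ}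
    (hn : 1 ≤ n) (hc : ContDiff ℝ n f) : ∃ L, 0 ≤ L ∧ ∀ s t, |f s - f t| ≤ L * |s - t| := by
  have hc1 : ContDiff ℝ (1 : ℕ) f := hc.of_le (by exact_mod_cast hn)
  have h1 := hc1.continuous_iteratedDeriv 1 le_rfl
  have h2 := periodic_iteratedDeriv hf 1
  rw [iteratedDeriv_one] at h1 h2
  obtain ⟨L, hL, hb⟩ := exists_abs_le_of_periodic h2 h1
  exact ⟨L, hL, fun s t => Convex.norm_image_sub_le_of_norm_deriv_le
    (fun u _ => hc1.differentiable (by simp) u) (fun u _ => hb u) convex_univ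
    (mem_univ t) (mem_univ s)⟩

/-- sharp L¹ estimate for conjugates of the class W^r K. -/
theorem conj_L1_sup_WrK (r : ℕ) (hr : 2 ≤ r) (K : ℝ) (hK : 0 < K) :
    sSup {y : ℝ | ∃ f g : ℝ → ℝ, MemWrK r K f ∧ ConjFn f g ∧
        y = ∫ t in (0:ℝ)..(2 * π), |g t|} =
      (16 * K / π) * ∑' i : ℕ, (-1 : ℝ) ^ (i * (r + 1)) / (2 * (i : ℝ) + 1) ^ (r + 2) := by
  obtain ⟨n, rfl⟩ : ∃ n, r = n + 1 := ⟨r - 1, by omega⟩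
  have hn : 1 ≤ n := by omega
  obtain ⟨A, hA, hbound⟩ := exists_sharp_constant hn
  have hlim := hA.const_mul (1 / π * K)
  rw [show ∀ S : ℝ, 1 / π * K * (16 * S) = 16 * K / π * S by intro S; ring] at hlim
  have hev : ∀ᶠ ρ : ℝ in nhdsWithin 1 (Iio 1), ρ ∈ Ioo (0 : ℝ) 1 := Ioo_mem_nhdsLT zero_lt_one
  have hupper : ∀ f, MemWrK (n + 1) K f → ∫ x in (0)..(2 * π), |conjugate f x| ≤
      (16 * K / π) * ∑' i : ℕ, (-1 : ℝ) ^ (i * (n + 1 + 1)) / (2 * (i : ℝ) + 1) ^ (n + 1 + 2) := by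
    rintro f ⟨pf, cf, lf⟩
    replace cf : ContDiff ℝ n f := cf
    obtain ⟨L, hL, hLip⟩ := exists_lipschitz_of_periodic pf hn cf
    refine le_of_tendsto_of_tendsto (tendsto_integral_abs_conjPoisson hL hLip) hlim ?_
    filter_upwards [hev] with ρ hρ
    rw [integral_abs_conjPoisson hρ.1.le hρ.2 pf cf, mul_assoc]
    refine mul_le_mul_of_nonneg_left ((hbound ρ hρ.1 hρ.2 K hK.le).1 _
      (periodic_iteratedDeriv pf n) fun s t => ?_) (one_div_pos.2 pi_pos).le
    have := lf.dist_le_mul s t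
    rwa [Real.coe_toNNReal _ hK.le] at this
  refine IsGreatest.csSup_eq ⟨?_, ?_⟩
  · obtain ⟨f, pf, cf, df, -⟩ := exists_iteratedDeriv_eq (φ := fun t => K * triangleWave t)
      (continuous_const.mul continuous_triangleWave)
      (fun t => by simp only [periodic_triangleWave t])
      (by rw [intervalIntegral.integral_const_mul, integral_triangleWave, mul_zero]) n
    have hf : MemWrK (n + 1) K f := by
      refine ⟨pf, cf, LipschitzWith.of_dist_le_mul fun s t => ?_⟩
      rw [Nat.add_sub_cancel, df, Real.coe_toNNReal _ hK.le, Real.dist_eq, Real.dist_eq,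
        ← mul_sub, abs_mul, abs_of_pos hK]
      exact mul_le_mul_of_nonneg_left (abs_triangleWave_sub_le s t) hK.le
    obtain ⟨L, hL, hLip⟩ := exists_lipschitz_of_periodic pf hn cf
    refine ⟨f, conjugate f, hf, conjAt_conjugate hL hLip, le_antisymm ?_ (hupper f hf)⟩
    refine le_of_tendsto_of_tendsto hlim (tendsto_integral_abs_conjPoisson hL hLip) ?_
    filter_upwards [hev] with ρ hρ
    rw [integral_abs_conjPoisson hρ.1.le hρ.2 pf cf, mul_assoc, df]
    exact mul_le_mul_of_nonneg_left (hbound ρ hρ.1 hρ.2 K hK.le).2 (one_div_pos.2 pi_pos).le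
  · rintro y ⟨f, g, hf, hg, rfl⟩
    obtain ⟨L, hL, hLip⟩ := exists_lipschitz_of_periodic hf.1 hn hf.2.1
    have : g = conjugate f := funext fun x => conjAt_unique (hg x) (conjAt_conjugate hL hLip x)
    rw [this]
    exact hupper f hf
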